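/- arXiv:1905.03505 — 8 statements merged into one kernel-verified Lean document; each statement's English description precedes it below -/
import Mathlib

section
/- Miranda's theorem: Let n ≥ 1 and let B = ∏_{i=1}^n [a_i^-, a_i^+] ⊆ ℝⁿ be a nondegenerate box (a_i^- < a_i^+ for all i). Let f = (f₁,…,f_n) : ℝⁿ → ℝⁿ be continuous on B. Suppose that for every i ∈ {1,…,n} one has f_i(x) > 0 for all x ∈ B with x_i = a_i^+, and f_i(x) < 0 for all x ∈ B with x_i = a_i^-. Then there exists x ∈ B with f(x) = 0, i.e., f has at least one zero in B. -/
/-- The lattice point `v` moved by one unit in direction `j`. -/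
def latticeStep {ι : Type*} [DecidableEq ι] (v : ι → ℕ) (j : ι) : ι → ℕ :=
  Function.update v j (v j + 1)

/-- The mod 2 coboundary of a cubical cochain on the lattice `ι → ℕ`. A cochain assigns a value to
the cube with lowest corner `v` and set of directions `S`. -/
def cubicalCoboundary {ι : Type*} [DecidableEq ι] (φ : (ι → ℕ) → Finset ι → ZMod 2)
    (v : ι → ℕ) (S : Finset ι) : ZMod 2 :=
  ∑ j ∈ S, (φ (latticeStep v j) (S.erase j) + φ v (S.erase j))

/-- The cup product of the coboundaries of the `0`-cochains `s i`, for `i` in a list. -/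
def coboundaryCup {ι : Type*} [DecidableEq ι] (s : ι → (ι → ℕ) → ZMod 2) :
    List ι → (ι → ℕ) → Finset ι → ZMod 2
  | [] => fun _ _ => 1
  | i :: l => cubicalCoboundary fun v S => s i v * coboundaryCup s l v S

/-- The lattice points whose coordinates are below `N` in the directions of `S` and equal to `N`
in the other ones. -/
def latticeFace {ι : Type*} [DecidableEq ι] [Fintype ι] (N : ℕ) (S : Finset ι) :
    Finset (ι → ℕ) :=
  Fintype.piFinset fun i => if i ∈ S then Finset.range N else {N}

section CubicalCochains

variable {ι : Type*} [DecidableEq ι]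

lemma latticeStep_comm (v : ι → ℕ) (j k : ι) :
    latticeStep (latticeStep v j) k = latticeStep (latticeStep v k) j := by
  rcases eq_or_ne j k with rfl | h
  · rfl
  · simp only [latticeStep, Function.update_of_ne h, Function.update_of_ne h.symm]
    exact Function.update_comm h _ _ v

lemma sum_sum_erase_eq_zero_of_symm (S : Finset ι) (F : ι → ι → ZMod 2)
    (hF : ∀ j k, F j k = F k j) : ∑ j ∈ S, ∑ k ∈ S.erase j, F j k = 0 := by
  rw [Finset.sum_sigma']
  refine Finset.sum_involution (fun p _ => ⟨p.2, p.1⟩) ?_ ?_ ?_ ?_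
  · rintro ⟨j, k⟩ _
    simp only [hF k j, CharTwo.add_self_eq_zero]
  · rintro ⟨j, k⟩ h _ heq
    simp only [Finset.mem_sigma, Finset.mem_erase] at h
    exact h.2.1 (congrArg Sigma.fst heq)
  · rintro ⟨j, k⟩ h
    simp only [Finset.mem_sigma, Finset.mem_erase] at h ⊢
    exact ⟨h.2.2, h.2.1.symm, h.1⟩
  · rintro ⟨j, k⟩ _
    rfl

lemma cubicalCoboundary_cubicalCoboundary (φ : (ι → ℕ) → Finset ι → ZMod 2) (v : ι → ℕ)
    (S : Finset ι) : cubicalCoboundary (cubicalCoboundary φ) v S = 0 := by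
  simp only [cubicalCoboundary, ← Finset.sum_add_distrib]
  refine sum_sum_erase_eq_zero_of_symm S (fun j k => φ (latticeStep (latticeStep v j) k)
    ((S.erase j).erase k) + φ (latticeStep v j) ((S.erase j).erase k) +
    (φ (latticeStep v k) ((S.erase j).erase k) + φ v ((S.erase j).erase k))) fun j k => ?_
  rw [latticeStep_comm v j k, Finset.erase_right_comm (a := j) (b := k)]
  ring

lemma cubicalCoboundary_coboundaryCup (s : ι → (ι → ℕ) → ZMod 2) (l : List ι) (v : ι → ℕ)
    (S : Finset ι) : cubicalCoboundary (coboundaryCup s l) v S = 0 := by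
  cases l with
  | nil => simp [cubicalCoboundary, coboundaryCup, CharTwo.add_self_eq_zero]
  | cons i l => exact cubicalCoboundary_cubicalCoboundary _ v S

lemma coboundaryCup_cons (s : ι → (ι → ℕ) → ZMod 2) (i : ι) (l : List ι) (v : ι → ℕ)
    (S : Finset ι) : coboundaryCup s (i :: l) v S =
      ∑ j ∈ S, (s i (latticeStep v j) + s i v) * coboundaryCup s l (latticeStep v j)
        (S.erase j) := by
  have h : s i v * cubicalCoboundary (coboundaryCup s l) v S = 0 := by
    rw [cubicalCoboundary_coboundaryCup, mul_zero]
  rw [← add_zero (coboundaryCup s (i :: l) v S), ← h, coboundaryCup, cubicalCoboundary,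
    cubicalCoboundary, Finset.mul_sum, ← Finset.sum_add_distrib]
  refine Finset.sum_congr rfl fun j _ => ?_
  linear_combination CharTwo.add_self_eq_zero (s i v * coboundaryCup s l v (S.erase j))

lemma exists_ne_of_coboundaryCup_ne_zero (s : ι → (ι → ℕ) → ZMod 2) (l : List ι) (v : ι → ℕ)
    (S : Finset ι) (h : coboundaryCup s l v S ≠ 0) (i : ι) (hi : i ∈ l) :
    ∃ p q : ι → ℕ, (∀ k, v k ≤ p k ∧ p k ≤ v k + if k ∈ S then 1 else 0) ∧
      (∀ k, v k ≤ q k ∧ q k ≤ v k + if k ∈ S then 1 else 0) ∧ s i p ≠ s i q := by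
  induction l generalizing v S with
  | nil => simp at hi
  | cons i' l ih =>
    rw [coboundaryCup_cons] at h
    obtain ⟨j, hj, hne⟩ := Finset.exists_ne_zero_of_sum_ne_zero h
    rcases List.mem_cons.1 hi with rfl | hi
    · refine ⟨latticeStep v j, v, fun k => ?_, fun k => by simp, fun heq => hne ?_⟩
      · by_cases hk : k = j
        · subst hk; simp [latticeStep, hj]
        · simp [latticeStep, hk]
      · rw [heq, CharTwo.add_self_eq_zero, zero_mul]
    · obtain ⟨p, q, hp, hq, hpq⟩ := ih _ _ (right_ne_zero_of_mul hne) hi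
      have key : ∀ r : ι → ℕ, (∀ k, latticeStep v j k ≤ r k ∧
          r k ≤ latticeStep v j k + if k ∈ S.erase j then 1 else 0) →
          ∀ k, v k ≤ r k ∧ r k ≤ v k + if k ∈ S then 1 else 0 := by
        intro r hr k
        have := hr k
        by_cases hk : k = j
        · subst hk
          simp only [latticeStep, Function.update_self, Finset.mem_erase, ne_eq, not_true_eq_false,
            false_and, if_false] at this
          simp only [hj, if_true]
          omega
        · simpa [latticeStep, hk] using this
      exact ⟨p, q, key p hp, key q hq, hpq⟩

lemma coboundaryCup_eq_zero_of_const (s : ι → (ι → ℕ) → ZMod 2) (l : List ι) (v : ι → ℕ)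
    (S : Finset ι) (j : ι) (hj : j ∈ l) (hS : j ∉ S) (c : ZMod 2)
    (hs : ∀ w : ι → ℕ, w j = v j → s j w = c) : coboundaryCup s l v S = 0 := by
  by_contra h
  obtain ⟨p, q, hp, hq, hpq⟩ := exists_ne_of_coboundaryCup_ne_zero s l v S h j hj
  have hp := hp j
  have hq := hq j
  simp only [hS, if_false] at hp hq
  exact hpq ((hs p (by omega)).trans (hs q (by omega)).symm)

variable [Fintype ι]

lemma sum_latticeFace (N : ℕ) (S : Finset ι) (j : ι) (hj : j ∈ S) (h : (ι → ℕ) → ZMod 2) :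
    ∑ v ∈ latticeFace N S, h v =
      ∑ w ∈ latticeFace N (S.erase j), ∑ t ∈ Finset.range N, h (Function.update w j t) := by
  rw [← Finset.sum_product']
  refine Finset.sum_bij' (fun v _ => (Function.update v j N, v j))
    (fun p _ => Function.update p.1 j p.2) ?_ ?_ ?_ ?_ ?_
  · intro v hv
    simp only [latticeFace, Fintype.mem_piFinset, Finset.mem_product] at hv ⊢
    refine ⟨fun k => ?_, by simpa [hj] using hv j⟩
    by_cases hk : k = j
    · subst hk; simp
    · simpa [hk] using hv k
  · rintro ⟨w, t⟩ hw
    simp only [latticeFace, Fintype.mem_piFinset, Finset.mem_product] at hw ⊢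
    intro k
    by_cases hk : k = j
    · subst hk; simpa [hj] using hw.2
    · simpa [hk] using hw.1 k
  · intro v _
    simp
  · rintro ⟨w, t⟩ hw
    simp only [latticeFace, Fintype.mem_piFinset, Finset.mem_product] at hw
    have hN : w j = N := by simpa using hw.1 j
    simp [← hN]
  · intro v _
    simp

lemma sum_latticeFace_latticeStep (N : ℕ) (S : Finset ι) (j : ι) (hj : j ∈ S)
    (h : (ι → ℕ) → ZMod 2) :
    ∑ v ∈ latticeFace N S, (h (latticeStep v j) + h v) =
      ∑ w ∈ latticeFace N (S.erase j), (h w + h (Function.update w j 0)) := by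
  rw [sum_latticeFace N S j hj]
  refine Finset.sum_congr rfl fun w hw => ?_
  have hN : w j = N := by
    simpa using Fintype.mem_piFinset.1 hw j
  have htel := Finset.sum_range_sub (fun t => h (Function.update w j t)) N
  have hw : Function.update w j N = w := by simp [← hN]
  simp only [CharTwo.sub_eq_add, hw] at htel
  simpa [latticeStep] using htel

lemma sum_coboundaryCup_eq_one (N : ℕ) (s : ι → (ι → ℕ) → ZMod 2)
    (h0 : ∀ i v, v i = 0 → s i v = 0) (h1 : ∀ i v, v i = N → s i v = 1)
    (l : List ι) (hl : l.Nodup) :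
    ∑ v ∈ latticeFace N l.toFinset, coboundaryCup s l v l.toFinset = 1 := by
  induction l with
  | nil => simp [coboundaryCup, latticeFace]
  | cons i l ih =>
    obtain ⟨hil, hl⟩ := List.nodup_cons.1 hl
    have hi : i ∈ (i :: l).toFinset := by simp
    have herase : (i :: l).toFinset.erase i = l.toFinset := by simp [hil]
    simp only [coboundaryCup, cubicalCoboundary]
    rw [Finset.sum_comm, Finset.sum_congr rfl fun j hj => sum_latticeFace_latticeStep N _ j hj
        fun v => s i v * coboundaryCup s l v ((i :: l).toFinset.erase j),
      Finset.sum_eq_single_of_mem i hi, herase, ← ih hl]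
    · refine Finset.sum_congr rfl fun w hw => ?_
      have hN : w i = N := by
        simpa [hil] using Fintype.mem_piFinset.1 hw i
      rw [h1 i w hN, h0 i _ (Function.update_self i 0 w), zero_mul, add_zero, one_mul]
    · intro j hj hji
      have hjl : j ∈ l := by simpa [hji] using hj
      refine Finset.sum_eq_zero fun w hw => ?_
      have hN : w j = N := by
        simpa using Fintype.mem_piFinset.1 hw j
      rw [coboundaryCup_eq_zero_of_const s l w _ j hjl (by simp) 1
          fun u hu => h1 j u (hu.trans hN),
        coboundaryCup_eq_zero_of_const s l _ _ j hjl (by simp) 0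
          fun u hu => h0 j u (hu.trans (Function.update_self j 0 w)), mul_zero, mul_zero, add_zero]

/-- A discrete form of Miranda's theorem: some unit cube of the lattice meets both values of
every `0`-cochain `s i`. -/
lemma exists_cube_forall_exists_ne (N : ℕ) (s : ι → (ι → ℕ) → ZMod 2)
    (h0 : ∀ i v, v i = 0 → s i v = 0) (h1 : ∀ i v, v i = N → s i v = 1) :
    ∃ v : ι → ℕ, ∀ i, ∃ p q : ι → ℕ, (∀ k, v k ≤ p k ∧ p k ≤ v k + 1) ∧
      (∀ k, v k ≤ q k ∧ q k ≤ v k + 1) ∧ s i p = 1 ∧ s i q = 0 := by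
  have hsum := sum_coboundaryCup_eq_one N s h0 h1 Finset.univ.toList (Finset.nodup_toList _)
  obtain ⟨v, _, hv⟩ := Finset.exists_ne_zero_of_sum_ne_zero (hsum ▸ one_ne_zero)
  refine ⟨v, fun i => ?_⟩
  obtain ⟨p, q, hp, hq, hpq⟩ := exists_ne_of_coboundaryCup_ne_zero s _ v _ hv i (by simp)
  simp only [Finset.toList_toFinset, Finset.mem_univ, if_true] at hp hq
  have hcases : ∀ x y : ZMod 2, x ≠ y → x = 1 ∧ y = 0 ∨ y = 1 ∧ x = 0 := by decide
  rcases hcases _ _ hpq with h | h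
  · exact ⟨p, q, hp, hq, h⟩
  · exact ⟨q, p, hq, hp, h⟩

end CubicalCochains

/-- The point with lattice coordinates `v` in the box `Set.Icc a b` cut into `N` equal slices along
every axis; coordinates above `N` are truncated. -/
noncomputable def gridPoint {ι : Type*} (a b : ι → ℝ) (N : ℕ) (v : ι → ℕ) : ι → ℝ :=
  fun i => a i + (b i - a i) * min ((v i : ℝ) / N) 1

lemma gridPoint_mem_Icc {ι : Type*} {a b : ι → ℝ} (hab : a ≤ b) (N : ℕ) (v : ι → ℕ) :
    gridPoint a b N v ∈ Set.Icc a b := by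
  have hmin (i : ι) : 0 ≤ min ((v i : ℝ) / N) 1 := le_min (by positivity) zero_le_one
  refine ⟨fun i => ?_, fun i => ?_⟩
  · have := mul_nonneg (sub_nonneg.2 (hab i)) (hmin i)
    simp only [gridPoint]
    linarith
  · have := mul_le_mul_of_nonneg_left (min_le_right ((v i : ℝ) / N) 1) (sub_nonneg.2 (hab i))
    simp only [gridPoint]
    linarith

lemma dist_gridPoint_le {ι : Type*} [Fintype ι] (a b : ι → ℝ) (N : ℕ) {v p : ι → ℕ}
    (hp : ∀ k, v k ≤ p k ∧ p k ≤ v k + 1) :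
    dist (gridPoint a b N p) (gridPoint a b N v) ≤ dist b a / N := by
  refine (dist_pi_le_iff (by positivity)).2 fun i => ?_
  have hmin : |min ((p i : ℝ) / N) 1 - min ((v i : ℝ) / N) 1| ≤ 1 / N := by
    have h1 : (v i : ℝ) ≤ p i := by exact_mod_cast (hp i).1
    have h2 : (p i : ℝ) ≤ v i + 1 := by exact_mod_cast (hp i).2
    refine (abs_min_sub_min_le_max _ _ _ _).trans (max_le ?_ (by simp))
    rw [← sub_div, abs_div, Nat.abs_cast, abs_of_nonneg (by linarith)]
    gcongr
    linarith
  have hba : |b i - a i| ≤ dist b a := by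
    rw [← Real.dist_eq]
    exact dist_le_pi_dist b a i
  calc dist (gridPoint a b N p i) (gridPoint a b N v i)
      = |b i - a i| * |min ((p i : ℝ) / N) 1 - min ((v i : ℝ) / N) 1| := by
        rw [Real.dist_eq, ← abs_mul]
        simp only [gridPoint]
        ring_nf
    _ ≤ dist b a * (1 / N) := mul_le_mul hba hmin (abs_nonneg _) dist_nonneg
    _ = dist b a / N := by ring


/-- **Miranda's theorem.** If `f` is continuous on the nondegenerate box
`B = ∏ [a i, b i]` and each component `f i` is positive on the face `x i = b i`
and negative on the face `x i = a i`, then `f` has a zero in `B`. -/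
theorem miranda (n : ℕ) (hn : 1 ≤ n) (a b : Fin n → ℝ) (hab : ∀ i, a i < b i)
    (f : (Fin n → ℝ) → (Fin n → ℝ)) (hf : ContinuousOn f (Set.Icc a b))
    (hplus : ∀ i : Fin n, ∀ x ∈ Set.Icc a b, x i = b i → 0 < f x i)
    (hminus : ∀ i : Fin n, ∀ x ∈ Set.Icc a b, x i = a i → f x i < 0) :
    ∃ x ∈ Set.Icc a b, f x = 0 := by
  have hab' : a ≤ b := fun i => (hab i).le
  by_contra! hne
  have hK : IsCompact (Set.Icc a b) := isCompact_Icc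
  obtain ⟨x₀, hx₀, hmin⟩ := hK.exists_isMinOn ⟨a, Set.left_mem_Icc.2 hab'⟩ hf.norm
  have hε : 0 < ‖f x₀‖ := norm_pos_iff.2 (hne x₀ hx₀)
  obtain ⟨δ, hδ, hδf⟩ := Metric.uniformContinuousOn_iff.1
    (hK.uniformContinuousOn_of_continuous hf) _ hε
  obtain ⟨N, hN⟩ := exists_nat_gt (dist b a / δ)
  have hN0 : (0 : ℝ) < N := (by positivity : 0 ≤ dist b a / δ).trans_lt hN
  have hNδ : dist b a / N < δ := by
    rw [div_lt_iff₀ hδ] at hN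
    rw [div_lt_iff₀ hN0]
    linarith
  let x := gridPoint a b N
  have hx (v : Fin n → ℕ) : x v ∈ Set.Icc a b := gridPoint_mem_Icc hab' N v
  obtain ⟨v, hv⟩ := exists_cube_forall_exists_ne N
    (fun i v => if 0 < f (x v) i then 1 else 0)
    (fun i v hi => if_neg (hminus i _ (hx v) (by simp [x, gridPoint, hi])).not_gt)
    (fun i v hi => if_pos (hplus i _ (hx v) (by simp [x, gridPoint, hi, hN0.ne'])))
  refine (hmin (hx v)).not_gt ((pi_norm_lt_iff hε).2 fun i => ?_)
  obtain ⟨p, q, hp, hq, hsp, hsq⟩ := hv i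
  have hfp : 0 < f (x p) i := by
    by_contra h
    simp [h] at hsp
  have hfq : f (x q) i ≤ 0 := by
    by_contra! h
    simp [h] at hsq
  have hclose {r : Fin n → ℕ} (hr : ∀ k, v k ≤ r k ∧ r k ≤ v k + 1) :
      |f (x r) i - f (x v) i| < ‖f x₀‖ :=
    (dist_le_pi_dist _ _ i).trans_lt
      (hδf _ (hx r) _ (hx v) ((dist_gridPoint_le a b N hr).trans_lt hNδ))
  have hcp := abs_lt.1 (hclose hp)
  have hcq := abs_lt.1 (hclose hq)
  rw [Real.norm_eq_abs, abs_lt]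
  constructor <;> linarith
end

section
/- Mean Value Theorem with second-order perturbation bound: Let f = (f₁,…,f_n) : ℝⁿ → ℝⁿ be twice continuously differentiable and let x, y ∈ ℝⁿ. Then there exists an n×n real matrix M such that f(x) − f(y) = M·(x − y) and |M_{ij} − ∂f_i/∂x_j(y)| ≤ K([x,y])_{ij} · ‖x − y‖ for all i, j ∈ {1,…,n}, where [x,y] = {x + t(y − x) : t ∈ [0,1]}. -/
/-- The partial derivative `∂f_i/∂x_j` at `x`. -/
noncomputable def pd (n : ℕ) (f : (Fin n → ℝ) → (Fin n → ℝ)) (i j : Fin n)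
    (x : Fin n → ℝ) : ℝ :=
  fderiv ℝ (fun y => f y i) x (Pi.single j 1)

/-- The matrix `K(C)` with entries `K(C)_{ij} = Σ_k sup_{x∈C} |∂²f_i/(∂x_j∂x_k)(x)|`. -/
noncomputable def Kmat (n : ℕ) (f : (Fin n → ℝ) → (Fin n → ℝ))
    (C : Set (Fin n → ℝ)) : Matrix (Fin n) (Fin n) ℝ :=
  fun i j => ∑ k, sSup ((fun x => |fderiv ℝ (pd n f i j) x (Pi.single k 1)|) '' C)

theorem exists_fderiv_eq_sub {n : ℕ} {g : (Fin n → ℝ) → ℝ} (hg : Differentiable ℝ g)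
    (x y : Fin n → ℝ) :
    ∃ z ∈ segment ℝ x y, g x - g y = fderiv ℝ g z (x - y) := by
  obtain ⟨z, hz, h⟩ := domain_mvt (f := g) (s := Set.univ) (f' := fderiv ℝ g)
    (fun w _ => (hg w).hasFDerivAt.hasFDerivWithinAt) convex_univ
    (Set.mem_univ y) (Set.mem_univ x)
  exact ⟨z, segment_symm ℝ y x ▸ hz, h⟩

theorem clm_apply_eq_sum_single {n : ℕ} (L : (Fin n → ℝ) →L[ℝ] ℝ) (v : Fin n → ℝ) :
    L v = ∑ k, L (Pi.single k 1) * v k := by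
  conv_lhs => rw [pi_eq_sum_univ' v, map_sum]
  refine Finset.sum_congr rfl fun k _ => ?_
  rw [map_smul, smul_eq_mul, mul_comm]

theorem contDiff_pd {n : ℕ} {f : (Fin n → ℝ) → (Fin n → ℝ)} (hf : ContDiff ℝ 2 f)
    (i j : Fin n) : ContDiff ℝ 1 (pd n f i j) :=
  ((contDiff_pi.1 hf i).fderiv_right (m := 1) (by norm_num)).clm_apply contDiff_const

theorem isCompact_segment {n : ℕ} (x y : Fin n → ℝ) : IsCompact (segment ℝ x y) := by
  rw [segment_eq_image_lineMap]
  exact isCompact_Icc.image AffineMap.lineMap_continuous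

theorem abs_pd_sub_le {n : ℕ} {f : (Fin n → ℝ) → (Fin n → ℝ)} (hf : ContDiff ℝ 2 f)
    {x y z : Fin n → ℝ} (hz : z ∈ segment ℝ x y) (i j : Fin n) :
    |pd n f i j z - pd n f i j y| ≤ Kmat n f (segment ℝ x y) i j * ‖x - y‖ := by
  have hp := contDiff_pd hf i j
  obtain ⟨w, hw, h⟩ := exists_fderiv_eq_sub (hp.differentiable one_ne_zero) z y
  have hwxy : w ∈ segment ℝ x y :=
    (convex_segment x y).segment_subset hz (right_mem_segment ℝ x y) hw
  have hzy : ‖z - y‖ ≤ ‖x - y‖ := by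
    obtain ⟨a, b, ha, hb, hab, rfl⟩ := hz
    have : a • x + b • y - y = a • (x - y) := by
      rw [← eq_sub_iff_add_eq'] at hab
      subst hab
      module
    rw [this, norm_smul, Real.norm_of_nonneg ha]
    exact mul_le_of_le_one_left (norm_nonneg _) (by linarith)
  rw [h, clm_apply_eq_sum_single, Kmat, Finset.sum_mul]
  refine (Finset.abs_sum_le_sum_abs _ _).trans (Finset.sum_le_sum fun k _ => ?_)
  rw [abs_mul]
  have hcont : Continuous fun u => |fderiv ℝ (pd n f i j) u (Pi.single k 1)| :=
    ((hp.continuous_fderiv one_ne_zero).clm_apply continuous_const).abs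
  have hsup := le_csSup ((isCompact_segment x y).image hcont).bddAbove
    (Set.mem_image_of_mem _ hwxy)
  exact mul_le_mul hsup ((norm_le_pi_norm (z - y) k).trans hzy) (abs_nonneg _)
    ((abs_nonneg _).trans hsup)

/-- **Mean Value Theorem with second-order perturbation bound.** For a `C²` map
`f : ℝⁿ → ℝⁿ` and points `x, y`, there is a matrix `M` with
`f(x) − f(y) = M·(x − y)` whose entries differ from the Jacobian entries at `y`
by at most `K([x,y])_{ij} · ‖x − y‖` (sup norm). -/
theorem mvt_second_order (n : ℕ) (f : (Fin n → ℝ) → (Fin n → ℝ))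
    (hf : ContDiff ℝ 2 f) (x y : Fin n → ℝ) :
    ∃ M : Matrix (Fin n) (Fin n) ℝ,
      f x - f y = M.mulVec (x - y) ∧
      ∀ i j : Fin n,
        |M i j - pd n f i j y| ≤ Kmat n f (segment ℝ x y) i j * ‖x - y‖ := by
  have hd (i : Fin n) : Differentiable ℝ fun u => f u i :=
    (contDiff_pi.1 hf i).differentiable two_ne_zero
  choose z hz h using fun i => exists_fderiv_eq_sub (hd i) x y
  refine ⟨fun i j => pd n f i j (z i), ?_, fun i j => abs_pd_sub_le hf (hz i) i j⟩
  ext i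
  exact (h i).trans (clm_apply_eq_sum_single _ _)
end

section
/- Sure success of the abstract MK test: Let f : ℝⁿ → ℝⁿ be twice continuously differentiable, let α be a zero of f, and let B be a box of width w > 0 containing α. Let λ ≥ w and let Δ be the closed Euclidean ball of radius 2√n·λ centered at α. Assume: (i) J(x) is invertible for every x ∈ Δ; (ii) 27·n·λ·sup{ ‖ |J(x)⁻¹| · K(Δ) ‖ : x ∈ Δ } ≤ 1, where |J(x)⁻¹| is the entrywise absolute value of J(x)⁻¹. Let m ∈ B (so J(m) is invertible) and define g = (g₁,…,g_n) : ℝⁿ → ℝⁿ by g(x) = J(m)⁻¹·f(x). Then for every i ∈ {1,…,n}: g_i(x) ≥ w/4 for all x in the face (2B)_i^+, and g_i(x) ≤ −w/4 for all x in the face (2B)_i^-. -/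
/-- The Jacobian matrix of `f` at `x`. -/
noncomputable def Jmat (n : ℕ) (f : (Fin n → ℝ) → (Fin n → ℝ))
    (x : Fin n → ℝ) : Matrix (Fin n) (Fin n) ℝ :=
  fun i j => pd n f i j x

/-- The maximum-absolute-row-sum norm of a matrix. -/
noncomputable def rowSumNorm (n : ℕ) (A : Matrix (Fin n) (Fin n) ℝ) : ℝ :=
  ⨆ i, ∑ j, |A i j|

/-- The Euclidean distance on `Fin n → ℝ`. -/
noncomputable def eudist (n : ℕ) (x y : Fin n → ℝ) : ℝ :=
  Real.sqrt (∑ i, (x i - y i) ^ 2)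

/-- The box of width `w` centered at `c`. -/
def box (n : ℕ) (c : Fin n → ℝ) (w : ℝ) : Set (Fin n → ℝ) :=
  Set.Icc (fun i => c i - w / 2) (fun i => c i + w / 2)

/-- The `i`-th upper face of the box of width `w` centered at `c`. -/
def facePlus (n : ℕ) (c : Fin n → ℝ) (w : ℝ) (i : Fin n) : Set (Fin n → ℝ) :=
  {x ∈ box n c w | x i = c i + w / 2}

/-- The `i`-th lower face of the box of width `w` centered at `c`. -/
def faceMinus (n : ℕ) (c : Fin n → ℝ) (w : ℝ) (i : Fin n) : Set (Fin n → ℝ) :=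
  {x ∈ box n c w | x i = c i - w / 2}

/-- Mean value theorem for a scalar function on `Fin n → ℝ`, in coordinates. -/
theorem exists_mem_segment_sub_eq_sum {n : ℕ} {F : (Fin n → ℝ) → ℝ} (hF : Differentiable ℝ F)
    (x y : Fin n → ℝ) :
    ∃ z ∈ segment ℝ x y, F y - F x = ∑ j, (y j - x j) * fderiv ℝ F z (Pi.single j 1) := by
  obtain ⟨z, hz, h⟩ := domain_mvt (f := F) (f' := fderiv ℝ F) (s := Set.univ)
    (fun x _ => (hF x).hasFDerivAt.hasFDerivWithinAt) convex_univ (Set.mem_univ x)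
    (Set.mem_univ y)
  refine ⟨z, hz, ?_⟩
  rw [h]
  conv_lhs => rw [← Finset.univ_sum_single (y - x), map_sum]
  refine Finset.sum_congr rfl fun j _ => ?_
  rw [← Pi.sub_apply, ← smul_eq_mul, ← map_smul, ← Pi.single_smul, smul_eq_mul, mul_one]

theorem abs_pd_sub_le_Kmat_mul {n : ℕ} {f : (Fin n → ℝ) → (Fin n → ℝ)} (hf : ContDiff ℝ 2 f)
    {C s : Set (Fin n → ℝ)} (hC : IsCompact C) (hs : Convex ℝ s) (hsC : s ⊆ C)
    {x y : Fin n → ℝ} (hx : x ∈ s) (hy : y ∈ s) {r : ℝ} (hr : ∀ k, |y k - x k| ≤ r)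
    (i j : Fin n) : |pd n f i j y - pd n f i j x| ≤ Kmat n f C i j * r := by
  have hp := contDiff_pd hf i j
  obtain ⟨z, hz, h⟩ := exists_mem_segment_sub_eq_sum (hp.differentiable one_ne_zero) x y
  have hzC : z ∈ C := hsC (hs.segment_subset hx hy hz)
  rw [h, Kmat, Finset.sum_mul]
  refine (Finset.abs_sum_le_sum_abs _ _).trans (Finset.sum_le_sum fun k _ => ?_)
  have hcont : Continuous fun x => |fderiv ℝ (pd n f i j) x (Pi.single k 1)| :=
    ((hp.continuous_fderiv one_ne_zero).clm_apply continuous_const).abs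
  have hle := le_csSup (hC.bddAbove_image hcont.continuousOn) (Set.mem_image_of_mem _ hzC)
  rw [abs_mul, mul_comm]
  exact mul_le_mul hle (hr k) (abs_nonneg _) ((abs_nonneg _).trans hle)

theorem sum_abs_le_rowSumNorm {n : ℕ} (A : Matrix (Fin n) (Fin n) ℝ) (i : Fin n) :
    ∑ j, |A i j| ≤ rowSumNorm n A :=
  le_ciSup (f := fun i => ∑ j, |A i j|) (Set.finite_range _).bddAbove i

theorem rowSumNorm_le_sum {n : ℕ} (A : Matrix (Fin n) (Fin n) ℝ) :
    rowSumNorm n A ≤ ∑ i, ∑ j, |A i j| := by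
  have hnonneg (i : Fin n) : 0 ≤ ∑ j, |A i j| := Finset.sum_nonneg fun j _ => abs_nonneg _
  exact Real.iSup_le
    (fun i => Finset.single_le_sum (f := fun i => ∑ j, |A i j|) (fun i _ => hnonneg i)
      (Finset.mem_univ i))
    (Finset.sum_nonneg fun i _ => hnonneg i)

theorem continuousOn_Jmat_inv {n : ℕ} {f : (Fin n → ℝ) → (Fin n → ℝ)} (hf : ContDiff ℝ 2 f)
    {C : Set (Fin n → ℝ)} (hinv : ∀ x ∈ C, IsUnit (Jmat n f x)) :
    ContinuousOn (fun x => (Jmat n f x)⁻¹) C := by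
  have hJ : Continuous (Jmat n f) :=
    continuous_pi fun i => continuous_pi fun j => (contDiff_pd hf i j).continuous
  simp only [Matrix.inv_def, Ring.inverse_eq_inv']
  exact (hJ.matrix_det.continuousOn.inv₀ fun x hx =>
    ((Matrix.isUnit_iff_isUnit_det _).mp (hinv x hx)).ne_zero).smul
      hJ.matrix_adjugate.continuousOn

theorem bddAbove_rowSumNorm_abs_Jmat_inv_mul {n : ℕ} {f : (Fin n → ℝ) → (Fin n → ℝ)}
    (hf : ContDiff ℝ 2 f) {C : Set (Fin n → ℝ)} (hC : IsCompact C)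
    (hinv : ∀ x ∈ C, IsUnit (Jmat n f x)) (K : Matrix (Fin n) (Fin n) ℝ) :
    BddAbove ((fun x => rowSumNorm n (((Jmat n f x)⁻¹.map fun a => |a|) * K)) '' C) := by
  have hcont : ContinuousOn
      (fun x => ∑ i, ∑ j, |(((Jmat n f x)⁻¹.map fun a => |a|) * K) i j|) C := by
    simp only [Matrix.mul_apply, Matrix.map_apply]
    refine continuousOn_finsetSum _ fun i _ => continuousOn_finsetSum _ fun j _ =>
      (continuousOn_finsetSum _ fun k _ => ContinuousOn.mul ?_ continuousOn_const).abs
    exact (continuousOn_pi.mp (continuousOn_pi.mp (continuousOn_Jmat_inv hf hinv) i) k).abs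
  obtain ⟨M, hM⟩ := hC.bddAbove_image hcont
  refine ⟨M, ?_⟩
  rintro _ ⟨x, hx, rfl⟩
  exact (rowSumNorm_le_sum _).trans (hM (Set.mem_image_of_mem _ hx))

theorem isCompact_setOf_eudist_le (n : ℕ) (a : Fin n → ℝ) (r : ℝ) :
    IsCompact {x | eudist n a x ≤ r} := by
  refine Metric.isCompact_of_isClosed_isBounded ?_ ?_
  · refine isClosed_le ?_ continuous_const
    unfold eudist
    fun_prop
  · refine Metric.isBounded_closedBall (x := a) (r := r) |>.subset fun x hx => ?_
    have hx : eudist n a x ≤ r := hx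
    have hr : 0 ≤ r := (Real.sqrt_nonneg _).trans hx
    rw [Metric.mem_closedBall, dist_comm, dist_pi_le_iff hr]
    intro i
    rw [Real.dist_eq]
    exact (Real.abs_le_sqrt (Finset.single_le_sum (f := fun i => (a i - x i) ^ 2)
      (fun i _ => sq_nonneg _) (Finset.mem_univ i))).trans hx

theorem eudist_le_of_forall_abs_sub_le {n : ℕ} {x y : Fin n → ℝ} {r : ℝ} (hr : 0 ≤ r)
    (h : ∀ i, |x i - y i| ≤ r) : eudist n x y ≤ Real.sqrt n * r := by
  rw [eudist, ← Real.sqrt_sq hr, ← Real.sqrt_mul (Nat.cast_nonneg n)]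
  refine Real.sqrt_le_sqrt ?_
  calc ∑ i, (x i - y i) ^ 2 ≤ ∑ _i : Fin n, r ^ 2 :=
        Finset.sum_le_sum fun i _ => sq_le_sq.mpr ((h i).trans (le_abs_self r))
    _ = n * r ^ 2 := by simp

theorem abs_sub_le_of_mem_box {n : ℕ} {c x y : Fin n → ℝ} {u v : ℝ} (hx : x ∈ box n c u)
    (hy : y ∈ box n c v) (k : Fin n) : |x k - y k| ≤ (u + v) / 2 := by
  have h1 := hx.1 k
  have h2 := hx.2 k
  have h3 := hy.1 k
  have h4 := hy.2 k
  simp only at h1 h2 h3 h4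
  rw [abs_le]
  constructor <;> linarith

theorem box_subset_box {n : ℕ} (c : Fin n → ℝ) {u v : ℝ} (h : u ≤ v) : box n c u ⊆ box n c v :=
  Set.Icc_subset_Icc (fun i => by simp only; linarith) fun i => by simp only; linarith

/-- If `s` is a convex subset of a compact set `C` and `J(m)` is invertible, then on `s` the
preconditioned map `J(m)⁻¹ f` differs from the identity (up to a translation) by an error that
is quadratic in the size of `s`. -/
theorem abs_preconditioned_sub_le {n : ℕ} {f : (Fin n → ℝ) → (Fin n → ℝ)} (hf : ContDiff ℝ 2 f)
    {C s : Set (Fin n → ℝ)} (hC : IsCompact C) (hs : Convex ℝ s) (hsC : s ⊆ C)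
    {a m x : Fin n → ℝ} (ha : a ∈ s) (hm : m ∈ s) (hx : x ∈ s)
    (hinv : IsUnit (Jmat n f m)) {r t : ℝ} (hr : 0 ≤ r) (hmr : ∀ z ∈ s, ∀ k, |z k - m k| ≤ r)
    (hxa : ∀ k, |x k - a k| ≤ t) (i : Fin n) :
    |((Jmat n f m)⁻¹.mulVec (f x) i - (Jmat n f m)⁻¹.mulVec (f a) i) - (x i - a i)| ≤
      t * r * rowSumNorm n (((Jmat n f m)⁻¹.map fun a => |a|) * Kmat n f C) := by
  set A := (Jmat n f m)⁻¹ with hA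
  have hfd (k : Fin n) : Differentiable ℝ fun y => f y k :=
    (contDiff_pi.mp hf k).differentiable two_ne_zero
  have hderiv (z : Fin n → ℝ) : HasFDerivAt (fun y => ∑ k, A i k * f y k)
      (∑ k, A i k • fderiv ℝ (fun y => f y k) z) z :=
    HasFDerivAt.fun_sum fun k _ => ((hfd k z).hasFDerivAt).const_mul (A i k)
  obtain ⟨z, hz, h⟩ := exists_mem_segment_sub_eq_sum
    (fun z => (hderiv z).differentiableAt) a x
  have hzs : z ∈ s := hs.segment_subset ha hx hz
  have hAJ (j : Fin n) : ∑ k, A i k * pd n f k j m = if i = j then 1 else 0 := by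
    have : (A * Jmat n f m) i j = (1 : Matrix (Fin n) (Fin n) ℝ) i j := by
      rw [hA, Matrix.nonsing_inv_mul _ ((Matrix.isUnit_iff_isUnit_det _).mp hinv)]
    simpa [Matrix.mul_apply, Jmat, Matrix.one_apply] using this
  have herr : (A.mulVec (f x) i - A.mulVec (f a) i) - (x i - a i) =
      ∑ j, (x j - a j) * ∑ k, A i k * (pd n f k j z - pd n f k j m) := by
    have hmul (y : Fin n → ℝ) : A.mulVec (f y) i = ∑ k, A i k * f y k := rfl
    rw [hmul, hmul, h, (hderiv z).fderiv]
    simp only [mul_sub, Finset.sum_sub_distrib, hAJ]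
    simp [pd]
  rw [herr]
  calc |∑ j, (x j - a j) * ∑ k, A i k * (pd n f k j z - pd n f k j m)|
      ≤ ∑ j, t * (r * |((A.map fun a => |a|) * Kmat n f C) i j|) := by
        refine (Finset.abs_sum_le_sum_abs _ _).trans (Finset.sum_le_sum fun j _ => ?_)
        rw [abs_mul]
        refine mul_le_mul (hxa j) ?_ (abs_nonneg _) ((abs_nonneg _).trans (hxa j))
        calc |∑ k, A i k * (pd n f k j z - pd n f k j m)|
            ≤ ∑ k, |A i k| * (Kmat n f C k j * r) := by
              refine (Finset.abs_sum_le_sum_abs _ _).trans (Finset.sum_le_sum fun k _ => ?_)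
              rw [abs_mul]
              exact mul_le_mul_of_nonneg_left
                (abs_pd_sub_le_Kmat_mul hf hC hs hsC hm hzs (hmr z hzs) k j) (abs_nonneg _)
          _ = r * ((A.map fun a => |a|) * Kmat n f C) i j := by
              rw [Matrix.mul_apply, Finset.mul_sum]
              refine Finset.sum_congr rfl fun k _ => ?_
              rw [Matrix.map_apply]
              ring
          _ ≤ _ := mul_le_mul_of_nonneg_left (le_abs_self _) hr
    _ = t * r * ∑ j, |((A.map fun a => |a|) * Kmat n f C) i j| := by
        simp only [Finset.mul_sum, mul_assoc]
    _ ≤ _ := mul_le_mul_of_nonneg_left (sum_abs_le_rowSumNorm _ i)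
        (mul_nonneg ((abs_nonneg _).trans (hxa i)) hr)

/-- **Sure success of the abstract MK test.** Under the stated smallness
conditions on the box `B` (of width `w`, containing the zero `α`), the
preconditioned system `g = J(m)⁻¹·f` satisfies `g_i ≥ w/4` on the face
`(2B)_i^+` and `g_i ≤ −w/4` on the face `(2B)_i^-`. -/
theorem mk_abstract_sure_success (n : ℕ) (f : (Fin n → ℝ) → (Fin n → ℝ))
    (hf : ContDiff ℝ 2 f) (α : Fin n → ℝ) (hroot : f α = 0)
    (c : Fin n → ℝ) (w : ℝ) (hw : 0 < w) (hα : α ∈ box n c w)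
    (lam : ℝ) (hlam : w ≤ lam)
    (Δ : Set (Fin n → ℝ)) (hΔ : Δ = {x | eudist n α x ≤ 2 * Real.sqrt n * lam})
    (hinv : ∀ x ∈ Δ, IsUnit (Jmat n f x))
    (hsmall : 27 * n * lam *
      sSup ((fun x => rowSumNorm n (((Jmat n f x)⁻¹.map fun a => |a|) * Kmat n f Δ))
        '' Δ) ≤ 1)
    (m : Fin n → ℝ) (hm : m ∈ box n c w)
    (g : (Fin n → ℝ) → (Fin n → ℝ)) (hg : ∀ x, g x = (Jmat n f m)⁻¹.mulVec (f x)) :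
    ∀ i : Fin n,
      (∀ x ∈ facePlus n c (2 * w) i, w / 4 ≤ g x i) ∧
      (∀ x ∈ faceMinus n c (2 * w) i, g x i ≤ -(w / 4)) := by
  intro i
  have hn : (1 : ℝ) ≤ n := by exact_mod_cast i.pos
  have hΔc : IsCompact Δ := hΔ ▸ isCompact_setOf_eudist_le n α _
  have hB : box n c w ⊆ box n c (2 * w) := box_subset_box c (by linarith)
  have hBΔ : box n c (2 * w) ⊆ Δ := fun x hx => by
    rw [hΔ, Set.mem_ofPred_eq]
    refine (eudist_le_of_forall_abs_sub_le (by positivity)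
      (abs_sub_le_of_mem_box hα hx)).trans ?_
    rw [mul_comm 2 (Real.sqrt n), mul_assoc]
    exact mul_le_mul_of_nonneg_left (by linarith) (Real.sqrt_nonneg _)
  have hS := le_csSup (bddAbove_rowSumNorm_abs_Jmat_inv_mul hf hΔc hinv (Kmat n f Δ))
    (Set.mem_image_of_mem _ (hBΔ (hB hm)))
  set S := rowSumNorm n (((Jmat n f m)⁻¹.map fun a => |a|) * Kmat n f Δ)
  have hS0 : 0 ≤ S :=
    (Finset.sum_nonneg fun j _ => abs_nonneg _).trans (sum_abs_le_rowSumNorm _ i)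
  have hwS : 27 * (w * S) ≤ 1 :=
    calc 27 * (w * S) = 27 * 1 * w * S := by ring
      _ ≤ 27 * n * lam * S := by gcongr
      _ ≤ _ := (mul_le_mul_of_nonneg_left hS (by have := hw.trans_le hlam; positivity)).trans
        hsmall
  have key (x) (hx : x ∈ box n c (2 * w)) : |g x i - (x i - α i)| ≤ w / 4 := by
    have h := abs_preconditioned_sub_le hf hΔc (convex_Icc _ _) hBΔ (hB hα) (hB hm) hx
      (hinv m (hBΔ (hB hm))) (r := (2 * w + w) / 2) (by positivity)
      (fun z hz => abs_sub_le_of_mem_box hz hm) (abs_sub_le_of_mem_box hx hα) i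
    rw [hroot, Matrix.mulVec_zero, Pi.zero_apply, sub_zero, ← hg] at h
    refine h.trans ?_
    have := mul_le_mul_of_nonneg_left hwS hw.le
    linarith
  have hα1 := hα.1 i
  have hα2 := hα.2 i
  simp only at hα1 hα2
  refine ⟨fun x hx => ?_, fun x hx => ?_⟩
  · have h := abs_le.mp (key x hx.1)
    have := hx.2
    linarith [h.1]
  · have h := abs_le.mp (key x hx.1)
    have := hx.2
    linarith [h.2]
end

section
/- Quadratic convergence of the mean value form: Let D ⊆ ℝⁿ be open, f : D → ℝ continuously differentiable, and B ⊆ D a box of width w centered at m. For each i ∈ {1,…,n} let I_i be a nonempty compact interval with {∂f/∂x_i(x) : x ∈ B} ⊆ I_i. Let M := f(m) + Σ_{i=1}^n I_i·[−w/2, w/2] (the mean value form interval). Then f(B) ⊆ M and the Hausdorff distance satisfies q(M, f(B)) ≤ 2·w·Σ_{i=1}^n w(I_i), where f(B) = {f(x) : x ∈ B} is the exact range. -/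
/-- Mean value expansion on a box: at a point of the box, `f` differs
from its central value by the linear form whose coefficients are the partial derivatives at an
intermediate point of the box. -/
theorem exists_partial_derivs_mean_value {n : ℕ} {f : (Fin n → ℝ) → ℝ}
    {f' : (Fin n → ℝ) → ((Fin n → ℝ) →L[ℝ] ℝ)} {c : Fin n → ℝ} {w : ℝ} (hw : 0 < w)
    (hf : ∀ x ∈ box n c w, HasFDerivAt f (f' x) x) {x : Fin n → ℝ} (hx : x ∈ box n c w) :
    ∃ z ∈ box n c w, f x = f c + ∑ i, f' z (Pi.single i 1) * (x i - c i) := by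
  have hconv : Convex ℝ (box n c w) := convex_Icc _ _
  have hc : c ∈ box n c w := ⟨fun i => by dsimp only; linarith, fun i => by dsimp only; linarith⟩
  obtain ⟨z, hz, hfz⟩ := domain_mvt (fun y hy => (hf y hy).hasFDerivWithinAt) hconv hc hx
  refine ⟨z, hconv.segment_subset hc hx hz, ?_⟩
  rw [← sub_eq_iff_eq_add', hfz]
  refine ((f' z).toLinearMap.pi_apply_eq_sum_univ (x - c)).trans ?_
  refine Finset.sum_congr rfl fun i _ => ?_
  have hsingle : (fun j => if i = j then (1 : ℝ) else 0) = Pi.single i 1 := by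
    ext j
    simp [Pi.single_apply, eq_comm]
  rw [hsingle, smul_eq_mul, mul_comm, Pi.sub_apply]
  rfl

/-- **Quadratic convergence of the mean value form.** Let `D ⊆ ℝⁿ` be open,
`f : D → ℝ` continuously differentiable with derivative `f'`, and `B ⊆ D` a box
of width `w` centered at `c`.  If for each `i` the range of `∂f/∂x_i` over `B`
lies in the interval `I_i = [iA i, iB i]`, and
`M = f(c) + Σ_i I_i·[−w/2, w/2]` is the mean value form interval, then
`f(B) ⊆ M` and the Hausdorff distance satisfies
`q(M, f(B)) ≤ 2·w·Σ_i w(I_i)`. -/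
theorem mean_value_form_quadratic (n : ℕ) (D : Set (Fin n → ℝ)) (hD : IsOpen D)
    (f : (Fin n → ℝ) → ℝ) (f' : (Fin n → ℝ) → ((Fin n → ℝ) →L[ℝ] ℝ))
    (hderiv : ∀ x ∈ D, HasFDerivAt f (f' x) x)
    (hcont : ContinuousOn f' D)
    (c : Fin n → ℝ) (w : ℝ) (hw : 0 < w) (hBD : box n c w ⊆ D)
    (iA iB : Fin n → ℝ) (hI : ∀ i, iA i ≤ iB i)
    (hImem : ∀ i : Fin n, ∀ x ∈ box n c w,
      f' x (Pi.single i 1) ∈ Set.Icc (iA i) (iB i))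
    (M : Set ℝ)
    (hM : M = {y | ∃ t s : Fin n → ℝ,
      (∀ i, t i ∈ Set.Icc (iA i) (iB i)) ∧
      (∀ i, s i ∈ Set.Icc (-(w / 2)) (w / 2)) ∧
      y = f c + ∑ i, t i * s i}) :
    f '' box n c w ⊆ M ∧
      Metric.hausdorffDist M (f '' box n c w) ≤ 2 * w * ∑ i, (iB i - iA i) := by
  have hf : ∀ x ∈ box n c w, HasFDerivAt f (f' x) x := fun x hx => hderiv x (hBD hx)
  have hsub : f '' box n c w ⊆ M := by
    rintro _ ⟨x, hx, rfl⟩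
    obtain ⟨z, hz, hfx⟩ := exists_partial_derivs_mean_value hw hf hx
    rw [hM]
    refine ⟨fun i => f' z (Pi.single i 1), fun i => x i - c i, fun i => hImem i z hz,
      fun i => ?_, hfx⟩
    have hl := hx.1 i
    have hr := hx.2 i
    dsimp only at hl hr
    constructor <;> linarith
  have hsum : 0 ≤ ∑ i, (iB i - iA i) := Finset.sum_nonneg fun i _ => sub_nonneg.2 (hI i)
  have hbound : 0 ≤ 2 * w * ∑ i, (iB i - iA i) := by positivity
  refine ⟨hsub, Metric.hausdorffDist_le_of_mem_dist hbound ?_ fun y hy =>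
    ⟨y, hsub hy, by rwa [dist_self]⟩⟩
  intro y hy
  rw [hM] at hy
  obtain ⟨t, s, ht, hs, rfl⟩ := hy
  have hx : c + s ∈ box n c w := by
    constructor <;> intro i <;> have hl := (hs i).1 <;> have hr := (hs i).2 <;>
      simp only [Pi.add_apply] <;> linarith
  obtain ⟨z, hz, hfx⟩ := exists_partial_derivs_mean_value hw hf hx
  refine ⟨f (c + s), Set.mem_image_of_mem f hx, ?_⟩
  rw [hfx, dist_add_left, Real.dist_eq, ← Finset.sum_sub_distrib, Finset.mul_sum]
  refine (Finset.abs_sum_le_sum_abs _ _).trans (Finset.sum_le_sum fun i _ => ?_)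
  have hcoef : |t i - f' z (Pi.single i 1)| ≤ iB i - iA i :=
    abs_sub_le_of_le_of_le (ht i).1 (ht i).2 (hImem i z hz).1 (hImem i z hz).2
  have hoff : |s i| ≤ 2 * w := (abs_le.2 (hs i)).trans (by linarith)
  rw [Pi.add_apply, add_sub_cancel_left, ← sub_mul, abs_mul, mul_comm]
  exact mul_le_mul hoff hcoef (abs_nonneg _) (by positivity)
end

section
/- Correctness of the MK (preconditioned Miranda) test: Let B ⊆ ℝⁿ be a box, let f : ℝⁿ → ℝⁿ be continuous on 2B, let A be an invertible n×n real matrix, and set g := A·f (componentwise, g(x) = A·f(x)). If for every i ∈ {1,…,n} one has g_i(x) > 0 for all x in the face (2B)_i^+ and g_i(x) < 0 for all x in the face (2B)_i^-, then f has at least one zero in 2B. -/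
namespace Kuhn

open Finset Equiv

variable {n : ℕ}

/-- The `k`-th vertex of the Kuhn simplex with lowest vertex `z` in which coordinate `j` is the
`σ j`-th one to be incremented. -/
def vert (z : Fin n → ℕ) (σ : Perm (Fin n)) (k : ℕ) : Fin n → ℕ :=
  fun j => z j + if (σ j : ℕ) < k then 1 else 0

/-- The increment of `a` along the `k`-th edge of a Kuhn simplex, modulo two. -/
def edge (a : (Fin n → ℕ) → ZMod 2) (z : Fin n → ℕ) (σ : Perm (Fin n)) (k : ℕ) : ZMod 2 :=
  a (vert z σ (k + 1)) + a (vert z σ k)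

/-- The number, modulo two, of Kuhn simplices in `[0, N]ⁿ` on whose `k`-th edge the label `a k`
changes, for all `k`. -/
def total (N : ℕ) (a : Fin n → (Fin n → ℕ) → ZMod 2) : ZMod 2 :=
  ∑ z ∈ Fintype.piFinset fun _ : Fin n => range N, ∑ σ : Perm (Fin n), ∏ k, edge (a k) z σ k

/-- The sum obtained from the inner sum in `total` by replacing the `m`-th factor with the value of
`u` at the `p`-th vertex and placing the `i`-th factor on the edge `b i`. -/
def slotSum (a : Fin n → (Fin n → ℕ) → ZMod 2) (m : Fin n) (u : (Fin n → ℕ) → ZMod 2)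
    (z : Fin n → ℕ) (b : Fin n → ℕ) (p : ℕ) : ZMod 2 :=
  ∑ σ : Perm (Fin n), u (vert z σ p) * ∏ i ∈ univ.erase m, edge (a i) z σ (b i)

/-- Labels separating opposite faces of the cube `[0, N]ⁿ`. -/
def Separating (N : ℕ) (a : Fin n → (Fin n → ℕ) → ZMod 2) : Prop :=
  ∀ i x, (x i = 0 → a i x = 0) ∧ (x i = N → a i x = 1)

theorem vert_swap_mul (z : Fin n → ℕ) (σ : Perm (Fin n)) {r k : ℕ} (hr : r + 1 < n)
    (hk : k ≠ r + 1) :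
    vert z (swap ⟨r, by omega⟩ ⟨r + 1, hr⟩ * σ) k = vert z σ k := by
  funext j
  simp only [vert, Perm.mul_apply, Equiv.swap_apply_def]
  congr 1
  split_ifs <;> simp_all [Fin.ext_iff] <;> omega

theorem sum_eq_zero_of_swap_invariant (G : Perm (Fin n) → ZMod 2) {r : ℕ} (hr : r + 1 < n)
    (hG : ∀ σ, G (swap ⟨r, by omega⟩ ⟨r + 1, hr⟩ * σ) = G σ) : ∑ σ, G σ = 0 := by
  refine Finset.sum_involution (fun σ _ => swap ⟨r, by omega⟩ ⟨r + 1, hr⟩ * σ) ?_ ?_ ?_ ?_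
  · intro σ _
    rw [hG]
    exact CharTwo.add_self_eq_zero _
  · intro σ _ _ h
    have := congrArg (fun τ : Perm (Fin n) => τ (σ⁻¹ ⟨r, by omega⟩)) h
    simp [Fin.ext_iff] at this
  · intro σ _
    exact mem_univ _
  · intro σ _
    simp [← mul_assoc]

/-- A factor can be moved to the next edge if the common vertex of the two edges is not used by any
other factor. -/
theorem slotSum_update (a : Fin n → (Fin n → ℕ) → ZMod 2) (m : Fin n) (u : (Fin n → ℕ) → ZMod 2)
    (z : Fin n → ℕ) (b b' : Fin n → ℕ) (p r : ℕ) (i₀ : Fin n) (hr : r + 1 < n) (hi₀ : i₀ ≠ m)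
    (h : b i₀ = r) (h' : b' i₀ = r + 1) (hp : p ≠ r + 1)
    (hb : ∀ i, i ≠ m → i ≠ i₀ → b' i = b i ∧ b i ≠ r ∧ b i ≠ r + 1) :
    slotSum a m u z b p = slotSum a m u z b' p := by
  rw [← CharTwo.add_eq_zero]
  unfold slotSum
  rw [← sum_add_distrib]
  have key : ∀ σ : Perm (Fin n),
      u (vert z σ p) * ∏ i ∈ univ.erase m, edge (a i) z σ (b i)
        + u (vert z σ p) * ∏ i ∈ univ.erase m, edge (a i) z σ (b' i)
      = u (vert z σ p) * (a i₀ (vert z σ (r + 2)) + a i₀ (vert z σ r))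
        * ∏ i ∈ (univ.erase m).erase i₀, edge (a i) z σ (b i) := by
    intro σ
    have hmem : i₀ ∈ univ.erase m := by simp [hi₀]
    have hrest : ∏ i ∈ (univ.erase m).erase i₀, edge (a i) z σ (b' i)
        = ∏ i ∈ (univ.erase m).erase i₀, edge (a i) z σ (b i) := by
      refine prod_congr rfl fun i hi => ?_
      simp only [mem_erase, mem_univ, and_true] at hi
      rw [(hb i hi.2 hi.1).1]
    rw [← mul_prod_erase _ _ hmem, ← mul_prod_erase _ _ hmem, hrest, h, h']
    simp only [edge.eq_1 (a i₀)]
    linear_combination (u (vert z σ p) * a i₀ (vert z σ (r + 1))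
      * ∏ i ∈ (univ.erase m).erase i₀, edge (a i) z σ (b i)) * CharTwo.two_eq_zero (R := ZMod 2)
  rw [sum_congr rfl fun σ _ => key σ]
  refine sum_eq_zero_of_swap_invariant _ hr fun σ => ?_
  rw [vert_swap_mul z σ hr hp, vert_swap_mul z σ hr (by omega), vert_swap_mul z σ hr (by omega)]
  congr 1
  refine prod_congr rfl fun i hi => ?_
  simp only [mem_erase, mem_univ, and_true] at hi
  obtain ⟨-, h1, h2⟩ := hb i hi.2 hi.1
  unfold edge
  rw [vert_swap_mul z σ hr (by omega), vert_swap_mul z σ hr h2]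

theorem slotSum_congr (a : Fin n → (Fin n → ℕ) → ZMod 2) (m : Fin n) (u : (Fin n → ℕ) → ZMod 2)
    (z : Fin n → ℕ) {b b' : Fin n → ℕ} (p : ℕ) (h : ∀ i, i ≠ m → b i = b' i) :
    slotSum a m u z b p = slotSum a m u z b' p := by
  unfold slotSum
  refine sum_congr rfl fun σ _ => ?_
  congr 1
  refine prod_congr rfl fun i hi => ?_
  simp only [mem_erase, mem_univ, and_true] at hi
  rw [h i hi]

/-- The placement of the factors other than the `m`-th one on the first `n - 1` edges. -/
def lowEdge (m i : Fin n) : ℕ := if m < i then i - 1 else i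

theorem slotSum_lower (a : Fin n → (Fin n → ℕ) → ZMod 2) (m : Fin n) (u : (Fin n → ℕ) → ZMod 2)
    (z : Fin n → ℕ) :
    slotSum a m u z (fun i => i) m = slotSum a m u z (lowEdge m) m := by
  have step : ∀ g : ℕ, m + g < n → slotSum a m u z (fun i => i) m =
      slotSum a m u z (fun i => if m < i ∧ (i : ℕ) ≤ m + g then (i : ℕ) - 1 else i) m := by
    intro g
    induction g with
    | zero =>
      intro _
      refine slotSum_congr _ _ _ _ _ fun i _ => ?_
      simp only [Fin.lt_def]
      split_ifs <;> omega
    | succ g ih =>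
      intro hg
      rw [ih (by omega)]
      symm
      refine slotSum_update a m u z _ _ m (m + g) ⟨m + (g + 1), hg⟩ (by omega) ?_ ?_ ?_ (by omega) ?_
      · simp [Fin.ext_iff]
      · simp [Fin.lt_def]
      · simp [Fin.lt_def]; omega
      · intro i h1 h2
        simp only [Fin.ext_iff, Fin.lt_def, ne_eq] at h1 h2 ⊢
        split_ifs <;> omega
  have hm := m.2
  rw [step (n - 1 - m) (by omega)]
  refine slotSum_congr _ _ _ _ _ fun i _ => ?_
  have hi := i.2
  simp only [lowEdge, Fin.lt_def]
  split_ifs <;> omega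

theorem slotSum_upper (a : Fin n → (Fin n → ℕ) → ZMod 2) (m : Fin n) (u : (Fin n → ℕ) → ZMod 2)
    (z : Fin n → ℕ) :
    slotSum a m u z (fun i => i) (m + 1) = slotSum a m u z (fun i => lowEdge m i + 1) (m + 1) := by
  have step : ∀ g : ℕ, g ≤ m → slotSum a m u z (fun i => i) (m + 1) =
      slotSum a m u z (fun i => if i < m ∧ (m : ℕ) - g ≤ i then (i : ℕ) + 1 else i) (m + 1) := by
    intro g
    induction g with
    | zero =>
      intro _
      refine slotSum_congr _ _ _ _ _ fun i _ => ?_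
      simp only [Fin.lt_def]
      split_ifs <;> omega
    | succ g ih =>
      intro hg
      have hm := m.2
      rw [ih (by omega)]
      refine slotSum_update a m u z _ _ (m + 1) (m - (g + 1)) ⟨m - (g + 1), by omega⟩ (by omega)
        ?_ ?_ ?_ (by omega) ?_
      · simp only [ne_eq, Fin.ext_iff]; omega
      · simp only [Fin.lt_def]; split_ifs <;> omega
      · simp only [Fin.lt_def]; split_ifs <;> omega
      · intro i h1 h2
        simp only [Fin.ext_iff, Fin.lt_def, ne_eq] at h1 h2 ⊢
        split_ifs <;> omega
  rw [step m le_rfl]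
  refine slotSum_congr _ _ _ _ _ fun i hi => ?_
  simp only [lowEdge, Fin.lt_def, ne_eq, Fin.ext_iff] at hi ⊢
  split_ifs <;> omega

theorem vert_finRotate_mul (z : Fin (n + 1) → ℕ) (σ : Perm (Fin (n + 1))) {k : ℕ} (hk : k ≤ n) :
    vert z (finRotate (n + 1) * σ) (k + 1) =
      vert (Function.update z (σ⁻¹ (Fin.last n)) (z (σ⁻¹ (Fin.last n)) + 1)) σ k := by
  funext j
  by_cases hj : σ j = Fin.last n
  · have : j = σ⁻¹ (Fin.last n) := by rw [← hj]; simp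
    subst this
    simp [vert]
    omega
  · have : j ≠ σ⁻¹ (Fin.last n) := by rintro rfl; simp at hj
    simp only [vert, Perm.mul_apply, coe_finRotate_of_ne_last hj, Function.update_of_ne this,
      add_lt_add_iff_right]

theorem sum_update_succ {N : ℕ} (h : (Fin n → ℕ) → ZMod 2) (j : Fin n)
    (hh : ∀ z, z j = 0 ∨ z j = N → h z = 0) :
    ∑ z ∈ Fintype.piFinset fun _ : Fin n => range N, h (Function.update z j (z j + 1)) =
      ∑ z ∈ Fintype.piFinset fun _ : Fin n => range N, h z := by
  refine Finset.sum_bij_ne_zero (fun z _ _ => Function.update z j (z j + 1)) ?_ ?_ ?_ ?_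
  · intro z hz hne
    simp only [Fintype.mem_piFinset, mem_range] at hz ⊢
    intro i
    by_cases hi : i = j
    · subst hi
      have h1 : z i + 1 ≠ N := fun h0 => hne (hh _ (by simp [h0]))
      have := hz i
      simp only [Function.update_self]
      omega
    · simpa [hi] using hz i
  · intro z _ _ z' _ _ heq
    funext i
    have := congrFun heq i
    by_cases hi : i = j
    · subst hi; simpa using this
    · simpa [hi] using this
  · intro z hz hne
    have h0 : z j ≠ 0 := fun h0 => hne (hh _ (by simp [h0]))
    have hu : Function.update (Function.update z j (z j - 1)) j
        (Function.update z j (z j - 1) j + 1) = z := by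
      funext i
      by_cases hi : i = j
      · subst hi; simp; omega
      · simp [hi]
    refine ⟨Function.update z j (z j - 1), ?_, ?_, hu⟩
    · simp only [Fintype.mem_piFinset, mem_range] at hz ⊢
      intro i
      by_cases hi : i = j
      · subst hi
        have := hz i
        simp only [Function.update_self]
        omega
      · simpa [hi] using hz i
    · rw [hu]; exact hne
  · intro z _ _
    rfl

theorem sum_slotSum_shift {N : ℕ} {a : Fin n → (Fin n → ℕ) → ZMod 2} (m : Fin n)
    (ha : ∀ i, i ≠ m → ∀ x, (x i = 0 → a i x = 0) ∧ (x i = N → a i x = 1))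
    {u : (Fin n → ℕ) → ZMod 2} (hu : ∀ x, x m = 0 ∨ x m = N → u x = 0) :
    ∑ z ∈ Fintype.piFinset fun _ : Fin n => range N,
        slotSum a m u z (fun i => lowEdge m i + 1) (m + 1) =
      ∑ z ∈ Fintype.piFinset fun _ : Fin n => range N, slotSum a m u z (lowEdge m) m := by
  obtain _ | n := n
  · exact m.elim0
  unfold slotSum
  rw [sum_comm, sum_comm (t := univ), ← Equiv.sum_comp (Equiv.mulLeft (finRotate (n + 1)))]
  refine sum_congr rfl fun σ _ => ?_
  have hlow : ∀ i, i ≠ m → lowEdge m i + 1 ≤ n := by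
    intro i hi
    have := i.2
    have := m.2
    simp only [lowEdge, Fin.lt_def, ne_eq, Fin.ext_iff] at hi ⊢
    split_ifs <;> omega
  set j := σ⁻¹ (Fin.last n) with hj
  have hσj : σ j = Fin.last n := by simp [hj]
  rw [← sum_update_succ (fun z => u (vert z σ m) *
    ∏ i ∈ univ.erase m, edge (a i) z σ (lowEdge m i)) j]
  · refine sum_congr rfl fun z _ => ?_
    simp only [Equiv.coe_mulLeft]
    rw [vert_finRotate_mul z σ (by omega)]
    congr 1
    refine prod_congr rfl fun i hi => ?_
    simp only [mem_erase, mem_univ, and_true] at hi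
    have := hlow i hi
    unfold edge
    rw [vert_finRotate_mul z σ this, vert_finRotate_mul z σ (by omega)]
  · intro z hz
    have hv : ∀ k ≤ n, vert z σ k j = z j := by
      intro k hk
      simp [vert, hσj, hk]
    by_cases hjm : j = m
    · rw [hu, zero_mul]
      rw [← hjm, hv _ (by omega)]
      exact hz
    · refine mul_eq_zero_of_right _ (prod_eq_zero (i := j) (by simp [hjm]) ?_)
      have h1 := hlow j hjm
      unfold edge
      rcases hz with hz | hz
      · rw [(ha j hjm _).1 (by rw [hv _ h1, hz]), (ha j hjm _).1 (by rw [hv _ (by omega), hz]),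
          add_zero]
      · rw [(ha j hjm _).2 (by rw [hv _ h1, hz]), (ha j hjm _).2 (by rw [hv _ (by omega), hz])]
        exact CharTwo.add_self_eq_zero _

theorem total_congr {N : ℕ} {a a' : Fin n → (Fin n → ℕ) → ZMod 2} (ha : Separating N a)
    (ha' : Separating N a') (m : Fin n) (h : ∀ i, i ≠ m → a i = a' i) : total N a = total N a' := by
  rw [← CharTwo.add_eq_zero]
  set u : (Fin n → ℕ) → ZMod 2 := fun x => a m x + a' m x with hu
  have hu0 : ∀ x, x m = 0 ∨ x m = N → u x = 0 := by
    rintro x (hx | hx)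
    · simp [hu, (ha m x).1 hx, (ha' m x).1 hx]
    · simp only [hu, (ha m x).2 hx, (ha' m x).2 hx]
      exact CharTwo.add_self_eq_zero _
  have key : total N a + total N a' = ∑ z ∈ Fintype.piFinset fun _ : Fin n => range N,
      (slotSum a m u z (fun i => i) (m + 1) + slotSum a m u z (fun i => i) m) := by
    unfold total slotSum
    simp only [← sum_add_distrib]
    refine sum_congr rfl fun z _ => sum_congr rfl fun σ _ => ?_
    have hrest : ∏ i ∈ univ.erase m, edge (a' i) z σ i = ∏ i ∈ univ.erase m, edge (a i) z σ i := by
      refine prod_congr rfl fun i hi => ?_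
      simp only [mem_erase, mem_univ, and_true] at hi
      rw [h i hi]
    rw [← mul_prod_erase univ _ (mem_univ m), ← mul_prod_erase univ _ (mem_univ m), hrest]
    simp only [edge, hu]
    ring
  rw [key, sum_add_distrib]
  simp only [slotSum_lower, slotSum_upper]
  rw [sum_slotSum_shift m (fun i _ => ha i) hu0]
  exact CharTwo.add_self_eq_zero _

/-- The labels telling whether a coordinate is nonzero. -/
def coordLabel (i : Fin n) (x : Fin n → ℕ) : ZMod 2 := if x i = 0 then 0 else 1

theorem separating_coordLabel {N : ℕ} (hN : 0 < N) :
    Separating N (coordLabel : Fin n → (Fin n → ℕ) → ZMod 2) := by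
  intro i x
  refine ⟨fun h => by simp [coordLabel, h], fun h => ?_⟩
  simp only [coordLabel]
  rw [if_neg (by omega)]

theorem total_coordLabel {N : ℕ} (hN : 0 < N) :
    total N (coordLabel : Fin n → (Fin n → ℕ) → ZMod 2) = 1 := by
  have hedge : ∀ (z : Fin n → ℕ) (σ : Perm (Fin n)) (k : Fin n),
      edge (coordLabel k) z σ k = if z k = 0 ∧ σ k = k then 1 else 0 := by
    intro z σ k
    simp only [edge, coordLabel, vert, Fin.ext_iff]
    split_ifs <;> first | rfl | contradiction | omega
  unfold total
  simp only [hedge]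
  rw [sum_eq_single (0 : Fin n → ℕ), sum_eq_single (1 : Perm (Fin n))]
  · simp
  · intro σ _ hσ
    obtain ⟨k, hk⟩ : ∃ k, σ k ≠ k := by
      by_contra! hc
      exact hσ (Equiv.ext hc)
    exact prod_eq_zero (mem_univ k) (if_neg fun h => hk h.2)
  · simp
  · intro z _ hz
    obtain ⟨k, hk⟩ := Function.ne_iff.mp hz
    exact sum_eq_zero fun σ _ => prod_eq_zero (mem_univ k) (if_neg fun h => hk h.1)
  · intro h
    exact absurd (by simp [hN]) h

theorem total_eq_one {N : ℕ} (hN : 0 < N) {a : Fin n → (Fin n → ℕ) → ZMod 2}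
    (ha : Separating N a) : total N a = 1 := by
  have hsep : ∀ s : Finset (Fin n), Separating N fun i => if i ∈ s then coordLabel i else a i := by
    intro s i x
    by_cases hi : i ∈ s
    · simpa [hi] using separating_coordLabel hN i x
    · simpa [hi] using ha i x
  have hs : ∀ s : Finset (Fin n), total N (fun i => if i ∈ s then coordLabel i else a i) =
      total N a := by
    intro s
    induction s using Finset.induction_on with
    | empty => simp
    | insert m s _ ih =>
      rw [← ih]
      refine total_congr (hsep _) (hsep _) m fun i hi => ?_
      simp [hi]
  rw [← hs univ, ← total_coordLabel (n := n) hN]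
  simp

/-- A cubical Sperner lemma: labels separating opposite faces all change along the edges of some
Kuhn simplex. -/
theorem exists_simplex {N : ℕ} (hN : 0 < N) {a : Fin n → (Fin n → ℕ) → ZMod 2}
    (ha : Separating N a) : ∃ (z : Fin n → ℕ) (σ : Perm (Fin n)), (∀ i, z i < N) ∧
      ∀ k : Fin n, a k (vert z σ (k + 1)) ≠ a k (vert z σ k) := by
  have h1 : total N a ≠ 0 := by rw [total_eq_one hN ha]; exact one_ne_zero
  obtain ⟨z, hz, h2⟩ := exists_ne_zero_of_sum_ne_zero h1
  obtain ⟨σ, -, h3⟩ := exists_ne_zero_of_sum_ne_zero h2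
  refine ⟨z, σ, by simpa using hz, fun k hk => prod_ne_zero_iff.mp h3 k (mem_univ k) ?_⟩
  rw [edge, hk]
  exact CharTwo.add_self_eq_zero _

end Kuhn

/-- Every box contains, at each scale `w / N`, a point close to sign changes of all coordinates of a
map that satisfies the Miranda sign conditions. -/
theorem exists_near_sign_changes {n : ℕ} {c : Fin n → ℝ} {w : ℝ} (hw : 0 < w)
    {g : (Fin n → ℝ) → (Fin n → ℝ)} (hplus : ∀ i, ∀ x ∈ facePlus n c w i, 0 < g x i)
    (hminus : ∀ i, ∀ x ∈ faceMinus n c w i, g x i < 0) {N : ℕ} (hN : 0 < N) :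
    ∃ p ∈ box n c w, ∀ k, ∃ q ∈ box n c w, ∃ q' ∈ box n c w,
      dist q p ≤ w / N ∧ dist q' p ≤ w / N ∧ 0 ≤ g q k ∧ g q' k ≤ 0 := by
  classical
  have hN' : (0 : ℝ) < N := by exact_mod_cast hN
  let P : (Fin n → ℕ) → Fin n → ℝ := fun x i => c i - w / 2 + x i * (w / N)
  have hNw : (N : ℝ) * (w / N) = w := by field_simp
  have hwN : 0 < w / N := by positivity
  have hP : ∀ x : Fin n → ℕ, (∀ i, x i ≤ N) → P x ∈ box n c w := by
    intro x hx
    refine ⟨fun i => ?_, fun i => ?_⟩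
    · have : 0 ≤ (x i : ℝ) * (w / N) := by positivity
      simp only [P]
      linarith
    · have : (x i : ℝ) * (w / N) ≤ N * (w / N) := by
        gcongr
        exact hx i
      simp only [P]
      linarith
  let a : Fin n → (Fin n → ℕ) → ZMod 2 := fun i x =>
    if x i = 0 then 0 else if x i = N then 1 else if 0 < g (P x) i then 1 else 0
  have ha : Kuhn.Separating N a := by
    intro i x
    refine ⟨fun h => by simp [a, h], fun h => ?_⟩
    simp [a, h, hN.ne']
  have hval : ∀ i (x : Fin n → ℕ), (∀ i, x i ≤ N) →
      a i x = if 0 < g (P x) i then 1 else 0 := by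
    intro i x hx
    simp only [a]
    split_ifs with h1 h2 h3 h4 h5
    · have := hminus i (P x) ⟨hP x hx, by simp [P, h1]⟩
      linarith
    · rfl
    · rfl
    · have := hplus i (P x) ⟨hP x hx, by simp only [P, h3, hNw]; ring⟩
      exact absurd this h4
    · rfl
    · rfl
  obtain ⟨z, σ, hz, hzσ⟩ := Kuhn.exists_simplex hN ha
  have hvert : ∀ k i, Kuhn.vert z σ k i ≤ N := by
    intro k i
    have := hz i
    simp only [Kuhn.vert]
    split_ifs <;> omega
  have hdist : ∀ k, dist (P (Kuhn.vert z σ k)) (P z) ≤ w / N := by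
    intro k
    rw [dist_pi_le_iff hwN.le]
    intro i
    simp only [P, Kuhn.vert, Real.dist_eq]
    split_ifs
    · rw [abs_le]
      push_cast
      constructor <;> linarith
    · simpa using hwN.le
  refine ⟨P z, hP z fun i => (hz i).le, fun k => ?_⟩
  have hk := hzσ k
  rw [hval k _ (hvert _), hval k _ (hvert _)] at hk
  by_cases h1 : 0 < g (P (Kuhn.vert z σ (k + 1))) k
  · refine ⟨_, hP _ (hvert (k + 1)), _, hP _ (hvert k), hdist _, hdist _, h1.le, ?_⟩
    by_contra! h2
    simp [h1, h2] at hk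
  · refine ⟨_, hP _ (hvert k), _, hP _ (hvert (k + 1)), hdist _, hdist _, ?_, not_lt.mp h1⟩
    by_contra! h2
    simp [h1, h2.not_gt] at hk

/-- The **Poincaré–Miranda theorem**. -/
theorem exists_zero_of_miranda {n : ℕ} {c : Fin n → ℝ} {w : ℝ} (hw : 0 < w)
    {g : (Fin n → ℝ) → (Fin n → ℝ)} (hg : ContinuousOn g (box n c w))
    (hplus : ∀ i, ∀ x ∈ facePlus n c w i, 0 < g x i)
    (hminus : ∀ i, ∀ x ∈ faceMinus n c w i, g x i < 0) : ∃ x ∈ box n c w, g x = 0 := by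
  choose p hp q hq q' hq' hd hd' hpos hneg using fun N : ℕ =>
    exists_near_sign_changes hw hplus hminus N.succ_pos
  obtain ⟨x, hx, φ, hφ, hlim⟩ := (isCompact_Icc : IsCompact (box n c w)).tendsto_subseq hp
  have hscale : Filter.Tendsto (fun N => w / ((φ N).succ : ℕ)) Filter.atTop (nhds 0) :=
    (tendsto_const_div_atTop_nhds_zero_nat w).comp
      ((Filter.tendsto_add_atTop_nat 1).comp hφ.tendsto_atTop)
  have hconv : ∀ (y : ℕ → Fin n → ℝ), (∀ N, y N ∈ box n c w) →
      (∀ N, dist (y N) (p N) ≤ w / (N.succ : ℕ)) → ∀ k,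
      Filter.Tendsto (fun N => g (y (φ N)) k) Filter.atTop (nhds (g x k)) := by
    intro y hy hyp k
    have hyx : Filter.Tendsto (fun N => y (φ N)) Filter.atTop (nhds x) := by
      refine (tendsto_iff_of_dist ?_).mp hlim
      refine squeeze_zero (fun _ => dist_nonneg) (fun N => ?_) hscale
      rw [dist_comm]
      exact hyp (φ N)
    have := (hg x hx).tendsto.comp
      (tendsto_nhdsWithin_iff.mpr ⟨hyx, Filter.Eventually.of_forall fun N => hy (φ N)⟩)
    exact tendsto_pi_nhds.mp this k
  refine ⟨x, hx, funext fun k => le_antisymm ?_ ?_⟩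
  · exact le_of_tendsto' (hconv (fun N => q' N k) (fun N => hq' N k) (fun N => hd' N k) k)
      fun N => hneg (φ N) k
  · exact ge_of_tendsto' (hconv (fun N => q N k) (fun N => hq N k) (fun N => hd N k) k)
      fun N => hpos (φ N) k

/-- **Correctness of the MK (preconditioned Miranda) test.** If `f` is
continuous on `2B`, `A` is an invertible matrix, and `g = A·f` satisfies
`g_i > 0` on each face `(2B)_i^+` and `g_i < 0` on each face `(2B)_i^-`,
then `f` has a zero in `2B`. -/
theorem mk_test_correct (n : ℕ) (c : Fin n → ℝ) (w : ℝ) (hw : 0 < w)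
    (f : (Fin n → ℝ) → (Fin n → ℝ)) (hf : ContinuousOn f (box n c (2 * w)))
    (A : Matrix (Fin n) (Fin n) ℝ) (hA : IsUnit A)
    (g : (Fin n → ℝ) → (Fin n → ℝ)) (hg : ∀ x, g x = A.mulVec (f x))
    (hplus : ∀ i : Fin n, ∀ x ∈ facePlus n c (2 * w) i, 0 < g x i)
    (hminus : ∀ i : Fin n, ∀ x ∈ faceMinus n c (2 * w) i, g x i < 0) :
    ∃ x ∈ box n c (2 * w), f x = 0 := by
  have hgc : ContinuousOn g (box n c (2 * w)) := by
    rw [funext hg]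
    exact (Continuous.matrix_mulVec continuous_const continuous_id).comp_continuousOn hf
  obtain ⟨x, hx, hx0⟩ := exists_zero_of_miranda (by positivity) hgc hplus hminus
  refine ⟨x, hx, Matrix.mulVec_injective_of_isUnit hA ?_⟩
  rw [← hg, hx0, Matrix.mulVec_zero]
end

section
/- Jacobian (uniqueness) test: Let B ⊆ ℝⁿ be a box and let f = (f₁,…,f_n) : ℝⁿ → ℝⁿ be continuously differentiable on 3B. For each i, j ∈ {1,…,n} let R_{ij} := [min_{x∈3B} ∂f_i/∂x_j(x), max_{x∈3B} ∂f_i/∂x_j(x)]. Suppose that every n×n real matrix M with M_{ij} ∈ R_{ij} for all i, j satisfies det M ≠ 0 (i.e., 0 is not contained in the determinant of the interval Jacobian matrix of f over 3B). Then f has at most one zero in 3B. -/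
/-- **Jacobian (uniqueness) test.** Let `f` be continuously differentiable on
`3B` with derivative `f'`, and for each `i, j` let
`R_{ij} = [min_{x∈3B} ∂f_i/∂x_j(x), max_{x∈3B} ∂f_i/∂x_j(x)]`.  If every matrix
with entries in the `R_{ij}` has nonzero determinant, then `f` has at most one
zero in `3B`. -/
theorem jacobian_test (n : ℕ) (c : Fin n → ℝ) (w : ℝ) (hw : 0 < w)
    (f : (Fin n → ℝ) → (Fin n → ℝ))
    (f' : (Fin n → ℝ) → ((Fin n → ℝ) →L[ℝ] (Fin n → ℝ)))
    (hderiv : ∀ x ∈ box n c (3 * w), HasFDerivWithinAt f (f' x) (box n c (3 * w)) x)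
    (hcont : ContinuousOn f' (box n c (3 * w)))
    (hJC : ∀ M : Matrix (Fin n) (Fin n) ℝ,
      (∀ i j : Fin n, M i j ∈ Set.Icc
        (sInf ((fun x => f' x (Pi.single j 1) i) '' box n c (3 * w)))
        (sSup ((fun x => f' x (Pi.single j 1) i) '' box n c (3 * w)))) →
      M.det ≠ 0) :
    ∀ x ∈ box n c (3 * w), ∀ y ∈ box n c (3 * w), f x = 0 → f y = 0 → x = y := by
  intro x hx y hy hfx hfy
  have hconv : Convex ℝ (box n c (3 * w)) := convex_Icc _ _
  have hcompact : IsCompact (box n c (3 * w)) := isCompact_Icc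
  have hmvt : ∀ i, ∃ z ∈ box n c (3 * w), f' z (y - x) i = 0 := by
    intro i
    obtain ⟨z, hz, h⟩ := domain_mvt
      (fun u hu => hasFDerivWithinAt_pi'.1 (hderiv u hu) i) hconv hx hy
    refine ⟨z, hconv.segment_subset hx hy hz, ?_⟩
    simpa [hfx, hfy] using h.symm
  choose z hz hzero using hmvt
  have himage : ∀ i j, IsCompact ((fun x => f' x (Pi.single j 1) i) '' box n c (3 * w)) :=
    fun i j => hcompact.image_of_continuousOn
      ((continuous_apply i).comp_continuousOn (hcont.clm_apply continuousOn_const))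
  have hdet := hJC (Matrix.of fun i j => f' (z i) (Pi.single j 1) i) fun i j =>
    ⟨csInf_le (himage i j).bddBelow (Set.mem_image_of_mem _ (hz i)),
      le_csSup (himage i j).bddAbove (Set.mem_image_of_mem _ (hz i))⟩
  refine (sub_eq_zero.1 (Matrix.eq_zero_of_mulVec_eq_zero hdet (funext fun i => ?_))).symm
  have hsum := congrFun (LinearMap.pi_apply_eq_sum_univ (f' (z i)).toLinearMap (y - x)) i
  simp only [ContinuousLinearMap.coe_coe, hzero i, Finset.sum_apply, Pi.smul_apply,
    smul_eq_mul] at hsum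
  simp only [Matrix.mulVec, dotProduct, Matrix.of_apply, Pi.zero_apply]
  rw [hsum]
  refine Finset.sum_congr rfl fun j _ => ?_
  have hsingle : (Pi.single j 1 : Fin n → ℝ) = fun k => if j = k then 1 else 0 := by
    ext k
    simp [Pi.single_apply, eq_comm]
  rw [mul_comm, hsingle]
end

section
/- Strict Jacobian test combined with MK implies a unique root: Let B ⊆ ℝⁿ be a box and let f : ℝⁿ → ℝⁿ be twice continuously differentiable. Assume: (i) det J(x) ≠ 0 for every x ∈ 3B (the strict Jacobian condition on B); (ii) there exists m ∈ (3/2)B and an invertible matrix J(m) such that g := J(m)⁻¹·f satisfies, for every i ∈ {1,…,n}, g_i(x) > 0 for all x in the face (3B)_i^+ and g_i(x) < 0 for all x in the face (3B)_i^- (i.e., the MK test succeeds on (3/2)B). Then f has exactly one zero in 3B. -/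
section

open Set MeasureTheory Filter Topology

theorem exists_polynomial_eval_eq_integral_det {α ι : Type*} [TopologicalSpace α]
    [MeasurableSpace α] [OpensMeasurableSpace α] [T2Space α] [Fintype ι] [DecidableEq ι]
    {μ : Measure α} [IsFiniteMeasureOnCompacts μ] {K : Set α} (hK : IsCompact K)
    {A : α → Matrix ι ι ℝ} (hA : Continuous A) :
    ∃ q : Polynomial ℝ, ∀ t : ℝ, q.eval t = ∫ x in K, (1 + t • A x).det ∂μ := by
  refine ⟨∑ σ : Equiv.Perm ι, ∑ s ∈ Finset.univ.powerset,
    Polynomial.monomial (Finset.univ \ s).card (∫ x in K, ((Equiv.Perm.sign σ : ℤ) : ℝ) *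
      ((∏ i ∈ s, (1 : Matrix ι ι ℝ) (σ i) i) * ∏ i ∈ Finset.univ \ s, A x (σ i) i) ∂μ), fun t => ?_⟩
  have hcont (i j : ι) : Continuous fun x => A x i j := hA.matrix_elem i j
  have hint (σ : Equiv.Perm ι) (s : Finset ι) : Integrable (fun x =>
      ((Equiv.Perm.sign σ : ℤ) : ℝ) * ((∏ i ∈ s, (1 : Matrix ι ι ℝ) (σ i) i) *
        ∏ i ∈ Finset.univ \ s, A x (σ i) i) * t ^ (Finset.univ \ s).card) (μ.restrict K) := by
    refine ContinuousOn.integrableOn_compact hK (Continuous.continuousOn ?_)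
    fun_prop
  have hexp (x : α) : (1 + t • A x).det = ∑ σ : Equiv.Perm ι, ∑ s ∈ Finset.univ.powerset,
      ((Equiv.Perm.sign σ : ℤ) : ℝ) * ((∏ i ∈ s, (1 : Matrix ι ι ℝ) (σ i) i) *
        ∏ i ∈ Finset.univ \ s, A x (σ i) i) * t ^ (Finset.univ \ s).card := by
    simp only [Matrix.det_apply', Matrix.add_apply, Matrix.smul_apply, smul_eq_mul,
      Finset.prod_add, Finset.mul_sum, Finset.prod_mul_distrib, Finset.prod_const]
    refine Finset.sum_congr rfl fun σ _ => Finset.sum_congr rfl fun s _ => ?_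
    ring
  simp only [hexp]
  rw [integral_finsetSum _ fun σ _ => integrable_finsetSum _ fun s _ => hint σ s]
  simp only [Polynomial.eval_finsetSum, Polynomial.eval_monomial]
  refine Finset.sum_congr rfl fun σ _ => ?_
  rw [integral_finsetSum _ fun s _ => hint σ s]
  refine Finset.sum_congr rfl fun s _ => ?_
  rw [integral_mul_const]

theorem injOn_add_smul_of_lipschitzOnWith {E : Type*} [NormedAddCommGroup E] [NormedSpace ℝ E]
    {s : Set E} {u : E → E} {C : NNReal} (hu : LipschitzOnWith C u s) {t : ℝ} (ht : 0 ≤ t)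
    (htC : t * C < 1) : InjOn (fun x => x + t • u x) s := by
  intro x hx y hy hxy
  have h1 : x - y = t • (u y - u x) := by
    rw [smul_sub, sub_eq_sub_iff_add_eq_add]
    simpa [add_comm] using hxy
  have h2 : ‖x - y‖ ≤ t * C * ‖x - y‖ := by
    conv_lhs => rw [h1]
    rw [norm_smul, Real.norm_of_nonneg ht, mul_assoc, norm_sub_rev x y]
    exact mul_le_mul_of_nonneg_left (hu.norm_sub_le hy hx) ht
  rw [← sub_eq_zero, ← norm_le_zero_iff]
  nlinarith [norm_nonneg (x - y)]

theorem image_add_smul_Icc {ι : Type*} [Fintype ι] {a b : ι → ℝ} (hab : a ≤ b)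
    {u : (ι → ℝ) → ι → ℝ} {C : NNReal} (hu : LipschitzOnWith C u (Icc a b))
    (ha : ∀ x ∈ Icc a b, ∀ i, x i = a i → u x i = 0)
    (hb : ∀ x ∈ Icc a b, ∀ i, x i = b i → u x i = 0) {t : ℝ} (ht : 0 ≤ t) (htC : t * C < 1) :
    (fun x => x + t • u x) '' Icc a b = Icc a b := by
  classical
  have hface (x : ι → ℝ) (hx : x ∈ Icc a b) (i : ι) (c : ℝ) (hc : c ∈ Icc (a i) (b i))
      (h0 : ∀ z ∈ Icc a b, z i = c → u z i = 0) : t * |u x i| ≤ |x i - c| := by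
    have hz : Function.update x i c ∈ Icc a b :=
      ⟨le_update_iff.2 ⟨hc.1, fun j _ => hx.1 j⟩,
        update_le_iff.2 ⟨hc.2, fun j _ => hx.2 j⟩⟩
    have h1 : |u x i| ≤ C * |x i - c| := by
      have h2 := hu.dist_le_mul x hx _ hz
      have h3 : dist x (Function.update x i c) ≤ |x i - c| := by
        refine (dist_pi_le_iff (abs_nonneg _)).2 fun j => ?_
        rcases eq_or_ne j i with rfl | hj
        · simp [Real.dist_eq]
        · simp [hj]
      have h4 := dist_le_pi_dist (u x) (u (Function.update x i c)) i
      rw [h0 _ hz (by simp), Real.dist_eq, sub_zero] at h4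
      exact h4.trans (h2.trans (by gcongr))
    nlinarith [abs_nonneg (x i - c)]
  apply Subset.antisymm
  · rintro _ ⟨x, hx, rfl⟩
    refine ⟨fun i => ?_, fun i => ?_⟩
    · have h := hface x hx i (a i) ⟨le_rfl, hab i⟩ fun z hz => ha z hz i
      rw [abs_of_nonneg (sub_nonneg.2 (hx.1 i))] at h
      simp only [Pi.add_apply, Pi.smul_apply, smul_eq_mul]
      nlinarith [neg_abs_le (u x i)]
    · have h := hface x hx i (b i) ⟨hab i, le_rfl⟩ fun z hz => hb z hz i
      rw [abs_sub_comm, abs_of_nonneg (sub_nonneg.2 (hx.2 i))] at h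
      simp only [Pi.add_apply, Pi.smul_apply, smul_eq_mul]
      nlinarith [le_abs_self (u x i)]
  · intro y hy
    set p : (ι → ℝ) → ι → ℝ := fun x i => projIcc (a i) (b i) (hab i) (x i) with hp
    have hpmem (x) : p x ∈ Icc a b :=
      ⟨fun i => (projIcc (a i) (b i) (hab i) (x i)).2.1,
        fun i => (projIcc (a i) (b i) (hab i) (x i)).2.2⟩
    have hplip (x z) : dist (p x) (p z) ≤ dist x z := by
      refine (dist_pi_le_iff dist_nonneg).2 fun i => ?_
      refine le_trans ?_ (dist_le_pi_dist x z i)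
      simpa [hp, Subtype.dist_eq] using (LipschitzWith.projIcc (hab i)).dist_le_mul (x i) (z i)
    have hcontr : ContractingWith (t.toNNReal * C) fun x => p (y - t • u (p x)) := by
      refine ⟨by rwa [← NNReal.coe_lt_coe, NNReal.coe_mul, Real.coe_toNNReal _ ht], ?_⟩
      refine LipschitzWith.of_dist_le_mul fun x z => (hplip _ _).trans ?_
      rw [dist_sub_left, dist_smul₀, NNReal.coe_mul, Real.coe_toNNReal _ ht, mul_assoc,
        Real.norm_of_nonneg ht]
      gcongr
      exact (hu.dist_le_mul _ (hpmem x) _ (hpmem z)).trans (by gcongr; exact hplip _ _)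
    obtain ⟨x, hx⟩ : ∃ x, p (y - t • u (p x)) = x := ⟨_, hcontr.fixedPoint_isFixedPt⟩
    have hxm : x ∈ Icc a b := hx ▸ hpmem _
    have hpx : p x = x := funext fun i => by
      simp [hp, projIcc_of_mem (hab i) ⟨hxm.1 i, hxm.2 i⟩]
    rw [hpx] at hx
    refine ⟨x, hxm, funext fun i => ?_⟩
    have hxi : (projIcc (a i) (b i) (hab i) (y i - t * u x i) : ℝ) = x i := congrFun hx i
    simp only [Pi.add_apply, Pi.smul_apply, smul_eq_mul]
    rcases le_total (y i - t * u x i) (a i) with h | h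
    · rw [projIcc_of_le_left _ h] at hxi
      have := ha x hxm i hxi.symm
      simp only [this] at h ⊢
      linarith [hy.1 i]
    rcases le_total (b i) (y i - t * u x i) with h' | h'
    · rw [projIcc_of_right_le _ h'] at hxi
      have := hb x hxm i hxi.symm
      simp only [this] at h' ⊢
      linarith [hy.2 i]
    · rw [projIcc_of_mem _ ⟨h, h'⟩] at hxi
      simp only at hxi
      linarith

theorem ContinuousLinearMap.det_one_add_smul {ι : Type*} [Fintype ι] [DecidableEq ι]
    (L : (ι → ℝ) →L[ℝ] ι → ℝ) (t : ℝ) :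
    (ContinuousLinearMap.id ℝ (ι → ℝ) + t • L).det =
      (1 + t • LinearMap.toMatrix' (L : (ι → ℝ) →ₗ[ℝ] ι → ℝ)).det := by
  rw [ContinuousLinearMap.det, ← LinearMap.det_toMatrix']
  simp

theorem continuous_toMatrix'_fderiv {ι : Type*} [Fintype ι] [DecidableEq ι]
    {u : (ι → ℝ) → ι → ℝ} (hu : ContDiff ℝ 1 u) :
    Continuous fun x => LinearMap.toMatrix' (fderiv ℝ u x : (ι → ℝ) →ₗ[ℝ] ι → ℝ) := by
  refine continuous_matrix fun i j => ?_
  simp only [LinearMap.toMatrix'_apply]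
  exact (continuous_apply i).comp ((hu.continuous_fderiv one_ne_zero).clm_apply continuous_const)

/-- If a `C¹` map sends each face of a box into itself, its Jacobian determinant integrates to the
volume of the box: along `(1 - t) id + t H` the integral is polynomial in `t`, and for small `t > 0`
this map is a bijection of the box. -/
theorem integral_det_fderiv_Icc {ι : Type*} [Fintype ι] {a b : ι → ℝ} (hab : a ≤ b)
    {H : (ι → ℝ) → ι → ℝ} (hH : ContDiff ℝ 1 H)
    (ha : ∀ x ∈ Icc a b, ∀ i, x i = a i → H x i = a i)
    (hb : ∀ x ∈ Icc a b, ∀ i, x i = b i → H x i = b i) :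
    ∫ x in Icc a b, (fderiv ℝ H x).det = ∏ i, (b i - a i) := by
  classical
  set u : (ι → ℝ) → ι → ℝ := fun x => H x - x with hu
  have hu1 : ContDiff ℝ 1 u := hH.sub contDiff_id
  obtain ⟨C, hC⟩ := hu1.contDiffOn.exists_lipschitzOnWith (s := Icc a b) one_ne_zero
    (convex_Icc a b) isCompact_Icc
  let A : (ι → ℝ) → Matrix ι ι ℝ :=
    fun x => LinearMap.toMatrix' (fderiv ℝ u x : (ι → ℝ) →ₗ[ℝ] ι → ℝ)
  have hAc : Continuous A := continuous_toMatrix'_fderiv hu1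
  obtain ⟨q, hq⟩ := exists_polynomial_eval_eq_integral_det (μ := volume)
    (isCompact_Icc (a := a) (b := b)) hAc
  have hpos : ∀ᶠ t : ℝ in 𝓝 0, ∀ x ∈ Icc a b, 0 < (1 + t • A x).det := by
    refine isCompact_Icc.eventually_forall_of_forall_eventually fun x _ => ?_
    have hc : Continuous fun z : ℝ × (ι → ℝ) => (1 + z.1 • A z.2).det := by fun_prop
    exact hc.continuousAt.eventually_const_lt (by simp)
  have hlt : ∀ᶠ t : ℝ in 𝓝 0, t * C < 1 := by
    have hc : Continuous fun t : ℝ => t * C := by fun_prop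
    exact hc.continuousAt.eventually_lt_const (by simp)
  have hsmall : ∀ᶠ t : ℝ in 𝓝[>] 0, q.eval t = (Polynomial.C (∏ i, (b i - a i))).eval t := by
    filter_upwards [self_mem_nhdsWithin, hpos.filter_mono nhdsWithin_le_nhds,
      hlt.filter_mono nhdsWithin_le_nhds] with t ht htpos htC
    have hder (x : ι → ℝ) : HasFDerivAt (fun x => x + t • u x)
        (ContinuousLinearMap.id ℝ (ι → ℝ) + t • fderiv ℝ u x) x :=
      (hasFDerivAt_id x).add (((hu1.differentiable one_ne_zero) x).hasFDerivAt.const_smul t)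
    have hcv := integral_image_eq_integral_abs_det_fderiv_smul volume measurableSet_Icc
      (fun x _ => (hder x).hasFDerivWithinAt)
      (injOn_add_smul_of_lipschitzOnWith hC (le_of_lt ht) htC) (fun _ => (1 : ℝ))
    rw [image_add_smul_Icc hab hC (fun x hx i hi => by simp [hu, ha x hx i hi, hi])
      (fun x hx i hi => by simp [hu, hb x hx i hi, hi]) (le_of_lt ht) htC] at hcv
    rw [hq, Polynomial.eval_C, ← Real.volume_Icc_pi_toReal hab]
    simp only [setIntegral_const, smul_eq_mul, mul_one] at hcv
    rw [← measureReal_def, hcv]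
    refine setIntegral_congr_fun measurableSet_Icc fun x hx => ?_
    simp only [ContinuousLinearMap.det_one_add_smul]
    exact (abs_of_pos (htpos x hx)).symm
  have hq1 : q = Polynomial.C (∏ i, (b i - a i)) := by
    refine Polynomial.eq_of_infinite_eval_eq _ _ ?_
    obtain ⟨δ, hδ, hsub⟩ := mem_nhdsGT_iff_exists_Ioo_subset.1 hsmall
    exact (Ioo_infinite hδ).mono hsub
  have h1 := hq 1
  rw [hq1, Polynomial.eval_C] at h1
  rw [h1]
  congr 1 with x
  have hx : fderiv ℝ H x = ContinuousLinearMap.id ℝ (ι → ℝ) + (1 : ℝ) • fderiv ℝ u x := by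
    rw [hu, fderiv_fun_sub (hH.differentiable one_ne_zero x) differentiableAt_fun_id, fderiv_fun_id]
    simp
  rw [hx, ContinuousLinearMap.det_one_add_smul]

theorem integral_prod_deriv_mul_det_fderiv_Icc {ι : Type*} [Fintype ι] {a b : ι → ℝ}
    (hab : ∀ i, a i < b i) {g : (ι → ℝ) → ι → ℝ} (hg : ContDiff ℝ 1 g) {s : ℝ → ℝ}
    (hs : ContDiff ℝ 1 s) (ha : ∀ x ∈ Icc a b, ∀ i, x i = a i → s (g x i) = 0)
    (hb : ∀ x ∈ Icc a b, ∀ i, x i = b i → s (g x i) = 1) :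
    ∫ x in Icc a b, (∏ i, deriv s (g x i)) * (fderiv ℝ g x).det = 1 := by
  classical
  have hgi (i : ι) : ContDiff ℝ 1 fun x => g x i := contDiff_pi.1 hg i
  have hmain := integral_det_fderiv_Icc (H := fun x i => a i + (b i - a i) * s (g x i))
    (fun i => (hab i).le)
    (contDiff_pi.2 fun i => contDiff_const.add (contDiff_const.mul (hs.comp (hgi i))))
    (fun x hx i hi => by simp [ha x hx i hi]) (fun x hx i hi => by simp [hb x hx i hi])
  have hdet (x : ι → ℝ) : (fderiv ℝ (fun x i => a i + (b i - a i) * s (g x i)) x).det =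
      (∏ i, (b i - a i)) * ((∏ i, deriv s (g x i)) * (fderiv ℝ g x).det) := by
    have hd : HasFDerivAt (fun x i => a i + (b i - a i) * s (g x i))
        (ContinuousLinearMap.pi fun i => (b i - a i) • deriv s (g x i) •
          (ContinuousLinearMap.proj i).comp (fderiv ℝ g x)) x := by
      refine hasFDerivAt_pi.2 fun i => (HasFDerivAt.const_mul ?_ _).const_add _
      exact (hs.differentiable one_ne_zero _).hasDerivAt.comp_hasFDerivAt x
        (hasFDerivAt_pi'.1 (hg.differentiable one_ne_zero x).hasFDerivAt i)
    rw [hd.fderiv, ← mul_assoc, ← Finset.prod_mul_distrib, ContinuousLinearMap.det,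
      ContinuousLinearMap.det, ← LinearMap.det_toMatrix', ← LinearMap.det_toMatrix',
      ← Matrix.det_diagonal, ← Matrix.det_mul]
    congr 1
    ext i j
    simp [LinearMap.toMatrix'_apply, Matrix.diagonal_mul, mul_assoc]
  simp only [hdet, integral_const_mul] at hmain
  exact mul_left_cancel₀ (Finset.prod_ne_zero_iff.2 fun i _ => (sub_pos.2 (hab i)).ne')
    (hmain.trans (mul_one _).symm)

theorem one_le_integral_prod_deriv_mul_abs_det_fderiv {ι : Type*} [Fintype ι]
    {g : (ι → ℝ) → ι → ℝ} (hg : ContDiff ℝ 1 g) {s : ℝ → ℝ} (hs : ContDiff ℝ 1 s)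
    (hmono : Monotone s) {ε : ℝ} (hε : 0 < ε) (hs0 : s (-ε) = 0) (hs1 : s ε = 1)
    {U : Set (ι → ℝ)} (hU : MeasurableSet U) (hinj : InjOn g U)
    (himg : Icc (fun _ => -ε) (fun _ => ε) ⊆ g '' U)
    (hint : IntegrableOn (fun x => (∏ i, deriv s (g x i)) * |(fderiv ℝ g x).det|) U) :
    1 ≤ ∫ x in U, (∏ i, deriv s (g x i)) * |(fderiv ℝ g x).det| := by
  have hone := integral_prod_deriv_mul_det_fderiv_Icc (ι := ι) (a := fun _ => -ε)
    (b := fun _ => ε) (fun _ => by linarith) contDiff_id hs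
    (fun x _ i hi => by simp [hi, hs0]) (fun x _ i hi => by simp [hi, hs1])
  have hid : ∀ x : ι → ℝ, (fderiv ℝ (id : (ι → ℝ) → ι → ℝ) x).det = 1 := fun x => by
    rw [fderiv_id]; simp [ContinuousLinearMap.det]
  simp only [hid, mul_one, id] at hone
  set V := U ∩ g ⁻¹' Icc (fun _ => -ε) (fun _ => ε) with hV
  have hVm : MeasurableSet V := hU.inter (measurableSet_Icc.preimage hg.continuous.measurable)
  have hVimg : g '' V = Icc (fun _ => -ε) (fun _ => ε) := by
    rw [hV, image_inter_preimage, inter_eq_right.2 himg]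
  have hcv := integral_image_eq_integral_abs_det_fderiv_smul volume hVm
    (fun x _ => (hg.differentiable one_ne_zero x).hasFDerivAt.hasFDerivWithinAt)
    (hinj.mono inter_subset_left) (fun y => ∏ i, deriv s (y i))
  rw [hVimg, hone] at hcv
  rw [hcv]
  simp only [smul_eq_mul, mul_comm |_|]
  refine setIntegral_mono_set hint (ae_of_all _ fun x => ?_) inter_subset_left.eventuallyLE
  exact mul_nonneg (Finset.prod_nonneg fun i _ => hmono.deriv_nonneg) (abs_nonneg _)

theorem exists_isOpen_injOn_image_mem_nhds {E : Type*} [NormedAddCommGroup E] [NormedSpace ℝ E]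
    [FiniteDimensional ℝ E] {g : E → E} (hg : ContDiff ℝ 1 g) {p : E}
    (hp : (fderiv ℝ g p).det ≠ 0) {N : Set E} (hN : N ∈ 𝓝 p) :
    ∃ U ⊆ N, IsOpen U ∧ InjOn g U ∧ g '' U ∈ 𝓝 (g p) := by
  have := FiniteDimensional.complete ℝ E
  set L := (fderiv ℝ g p).toContinuousLinearEquivOfDetNeZero hp
  have hL : HasStrictFDerivAt g (L : E →L[ℝ] E) p :=
    hg.contDiffAt.hasStrictFDerivAt one_ne_zero
  refine ⟨interior N ∩ (hL.toOpenPartialHomeomorph g).source,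
    inter_subset_left.trans interior_subset,
    isOpen_interior.inter (hL.toOpenPartialHomeomorph g).open_source,
    (hL.toOpenPartialHomeomorph g).injOn.mono inter_subset_right, ?_⟩
  rw [← hL.map_nhds_eq_of_equiv]
  exact image_mem_map (inter_mem (interior_mem_nhds.2 hN)
    ((hL.toOpenPartialHomeomorph g).open_source.mem_nhds hL.mem_toOpenPartialHomeomorph_source))

theorem exists_smooth_step {ε : ℝ} (hε : 0 < ε) :
    ∃ s : ℝ → ℝ, ContDiff ℝ 1 s ∧ Monotone s ∧ (∀ y ≤ -ε, s y = 0) ∧ (∀ y, ε ≤ y → s y = 1) ∧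
      ∀ y, ε < |y| → deriv s y = 0 := by
  set s : ℝ → ℝ := fun y => Real.smoothTransition ((y / ε + 1) / 2) with hs
  have h0 : ∀ y ≤ -ε, s y = 0 := fun y hy => Real.smoothTransition.zero_of_nonpos <| by
    have : y / ε ≤ -1 := by rw [div_le_iff₀ hε]; linarith
    linarith
  have h1 : ∀ y, ε ≤ y → s y = 1 := fun y hy => Real.smoothTransition.one_of_one_le <| by
    have : 1 ≤ y / ε := by rw [le_div_iff₀ hε]; linarith
    linarith
  refine ⟨s, ?_, ?_, h0, h1, fun y hy => ?_⟩
  · exact (Real.smoothTransition.contDiff (n := 1)).comp (by fun_prop)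
  · exact Real.smoothTransition.monotone.comp fun x y hxy => by gcongr
  · rcases lt_abs.1 hy with h | h
    · have : s =ᶠ[𝓝 y] fun _ => 1 :=
        (eventually_gt_nhds h).mono fun z hz => h1 z hz.le
      rw [this.deriv_eq, deriv_const]
    · have : s =ᶠ[𝓝 y] fun _ => 0 :=
        (eventually_lt_nhds (lt_neg.1 h)).mono fun z hz => h0 z hz.le
      rw [this.deriv_eq, deriv_const]

/-- A `C¹` map that is nondegenerate on a box, negative on the lower faces and positive on the upper
faces has exactly one zero in the box. -/
theorem existsUnique_zero_Icc_of_det_fderiv_ne_zero {ι : Type*} [Fintype ι] {a b : ι → ℝ}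
    (hab : ∀ i, a i < b i) {g : (ι → ℝ) → ι → ℝ} (hg : ContDiff ℝ 1 g)
    (hdet : ∀ x ∈ Icc a b, (fderiv ℝ g x).det ≠ 0)
    (ha : ∀ x ∈ Icc a b, ∀ i, x i = a i → g x i < 0)
    (hb : ∀ x ∈ Icc a b, ∀ i, x i = b i → 0 < g x i) :
    ∃! x, x ∈ Icc a b ∧ g x = 0 := by
  have hgc (i : ι) : Continuous fun x => g x i := (continuous_apply i).comp hg.continuous
  have hdetc : Continuous fun x => (fderiv ℝ g x).det :=
    ContinuousLinearMap.continuous_det.comp (hg.continuous_fderiv one_ne_zero)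
  have hface (i : ι) (c : ℝ) : IsCompact (Icc a b ∩ {x | x i = c}) :=
    isCompact_Icc.inter_right (isClosed_eq (continuous_apply i) continuous_const)
  have hεb : ∀ᶠ ε : ℝ in 𝓝[>] 0, ∀ i, ∀ x ∈ Icc a b, x i = b i → ε ≤ g x i := by
    refine eventually_all.2 fun i => ?_
    obtain ⟨δ, hδ, h⟩ := (hface i (b i)).exists_forall_le' (hgc i).continuousOn
      fun x hx => hb x hx.1 i hx.2
    filter_upwards [Ioo_mem_nhdsGT hδ] with ε hε x hx hxi
    exact hε.2.le.trans (h x ⟨hx, hxi⟩)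
  have hεa : ∀ᶠ ε : ℝ in 𝓝[>] 0, ∀ i, ∀ x ∈ Icc a b, x i = a i → g x i ≤ -ε := by
    refine eventually_all.2 fun i => ?_
    obtain ⟨δ, hδ, h⟩ := (hface i (a i)).exists_forall_le' (hgc i).neg.continuousOn
      fun x hx => neg_pos.2 (ha x hx.1 i hx.2)
    filter_upwards [Ioo_mem_nhdsGT hδ] with ε hε x hx hxi
    exact le_neg.1 (hε.2.le.trans (h x ⟨hx, hxi⟩))
  have hstep {ε : ℝ} (hε1 : ∀ i, ∀ x ∈ Icc a b, x i = b i → ε ≤ g x i)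
      (hε2 : ∀ i, ∀ x ∈ Icc a b, x i = a i → g x i ≤ -ε) {s : ℝ → ℝ} (hs : ContDiff ℝ 1 s)
      (hs0 : ∀ y ≤ -ε, s y = 0) (hs1 : ∀ y, ε ≤ y → s y = 1) :
      ∫ x in Icc a b, (∏ i, deriv s (g x i)) * (fderiv ℝ g x).det = 1 :=
    integral_prod_deriv_mul_det_fderiv_Icc hab hg hs
      (fun x hx i hi => hs0 _ (hε2 i x hx hi)) (fun x hx i hi => hs1 _ (hε1 i x hx hi))
  have hnonneg {s : ℝ → ℝ} (hs : Monotone s) (x : ι → ℝ) : 0 ≤ ∏ i, deriv s (g x i) :=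
    Finset.prod_nonneg fun i _ => hs.deriv_nonneg
  refine existsUnique_of_exists_of_unique ?_ ?_
  · by_contra! hne
    obtain ⟨δ, hδ, hδg⟩ := isCompact_Icc.exists_forall_le' (s := Icc a b)
      hg.continuous.norm.continuousOn fun x hx => norm_pos_iff.2 (hne x hx)
    obtain ⟨ε, hε1, hε2, hε⟩ := (hεb.and (hεa.and (Ioo_mem_nhdsGT hδ))).exists
    obtain ⟨s, hs, -, hs0, hs1, hsd⟩ := exists_smooth_step hε.1
    have h := hstep hε1 hε2 hs hs0 hs1
    rw [setIntegral_congr_fun (g := fun _ => (0 : ℝ)) measurableSet_Icc, integral_zero] at h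
    · exact zero_ne_one h
    · intro x hx
      obtain ⟨i, hi⟩ : ∃ i, ε < |g x i| := by
        by_contra! hcon
        exact (hε.2.trans_le (hδg x hx)).not_ge ((pi_norm_le_iff_of_nonneg hε.1.le).2 hcon)
      simp only
      rw [Finset.prod_eq_zero (Finset.mem_univ i) (hsd _ hi), zero_mul]
  · rintro p q ⟨hpK, hp⟩ ⟨hqK, hq⟩
    by_contra hpq
    have hint {x : ι → ℝ} (hx : x ∈ Icc a b) (h0 : g x = 0) : Icc a b ∈ 𝓝 x := by
      refine pi_Icc_mem_nhds (fun i => (hx.1 i).lt_of_ne fun h => ?_)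
        fun i => (hx.2 i).lt_of_ne fun h => ?_
      · simpa [h0] using ha x hx i h.symm
      · simpa [h0] using hb x hx i h
    obtain ⟨N, M, hN, hM, hpN, hqM, hNM⟩ := t2_separation hpq
    obtain ⟨U, hU, hUo, hUi, hUg⟩ := exists_isOpen_injOn_image_mem_nhds hg (hdet p hpK)
      (inter_mem (hint hpK hp) (hN.mem_nhds hpN))
    obtain ⟨V, hV, hVo, hVi, hVg⟩ := exists_isOpen_injOn_image_mem_nhds hg (hdet q hqK)
      (inter_mem (hint hqK hq) (hM.mem_nhds hqM))
    have hUV : Disjoint U V :=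
      hNM.mono (hU.trans inter_subset_right) (hV.trans inter_subset_right)
    obtain ⟨δ, hδ, hball⟩ := Metric.mem_nhds_iff.1 (inter_mem (hp ▸ hUg) (hq ▸ hVg))
    obtain ⟨ε, hε1, hε2, hε⟩ := (hεb.and (hεa.and (Ioo_mem_nhdsGT hδ))).exists
    have hcube : Icc (fun _ => -ε) (fun _ => ε) ⊆ g '' U ∩ g '' V := fun y hy => by
      refine hball (mem_ball_zero_iff.2 (((pi_norm_le_iff_of_nonneg hε.1.le).2 fun i => ?_).trans_lt
        hε.2))
      exact abs_le.2 ⟨hy.1 i, hy.2 i⟩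
    obtain ⟨s, hs, hmono, hs0, hs1, -⟩ := exists_smooth_step hε.1
    have h := hstep hε1 hε2 hs hs0 hs1
    have hprodc : Continuous fun x => ∏ i, deriv s (g x i) :=
      continuous_finsetProd _ fun i _ => hs.continuous_deriv_one.comp (hgc i)
    have hsign : ∀ x ∈ Icc a b, 0 < (fderiv ℝ g x).det := by
      by_contra! hneg
      obtain ⟨y, hy, hy0⟩ := hneg
      have hall : ∀ x ∈ Icc a b, (fderiv ℝ g x).det ≤ 0 := by
        by_contra! hpos
        obtain ⟨z, hz, hz0⟩ := hpos
        obtain ⟨x, hx, hx0⟩ := (convex_Icc a b).isPreconnected.intermediate_value hy hz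
          hdetc.continuousOn ⟨hy0, hz0.le⟩
        exact hdet x hx hx0
      refine (zero_lt_one' ℝ).not_ge (h ▸ setIntegral_nonpos measurableSet_Icc fun x hx => ?_)
      exact mul_nonpos_of_nonneg_of_nonpos (hnonneg hmono x) (hall x hx)
    have hintK : IntegrableOn (fun x => (∏ i, deriv s (g x i)) * |(fderiv ℝ g x).det|) (Icc a b) :=
      (hprodc.mul hdetc.abs).continuousOn.integrableOn_compact isCompact_Icc
    have hUK : U ⊆ Icc a b := hU.trans inter_subset_left
    have hVK : V ⊆ Icc a b := hV.trans inter_subset_left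
    have h1 := one_le_integral_prod_deriv_mul_abs_det_fderiv hg hs hmono hε.1 (hs0 _ le_rfl)
      (hs1 _ le_rfl) hUo.measurableSet hUi (hcube.trans inter_subset_left) (hintK.mono_set hUK)
    have h2 := one_le_integral_prod_deriv_mul_abs_det_fderiv hg hs hmono hε.1 (hs0 _ le_rfl)
      (hs1 _ le_rfl) hVo.measurableSet hVi (hcube.trans inter_subset_right) (hintK.mono_set hVK)
    have h3 := setIntegral_mono_set hintK
      (ae_of_all _ fun x => mul_nonneg (hnonneg hmono x) (abs_nonneg _))
      (union_subset hUK hVK).eventuallyLE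
    rw [setIntegral_union hUV hVo.measurableSet (hintK.mono_set hUK) (hintK.mono_set hVK)] at h3
    rw [setIntegral_congr_fun measurableSet_Icc fun x hx => by
      simp only [abs_of_pos (hsign x hx)]; rfl] at h3
    linarith

end

/-- **Strict Jacobian test combined with MK implies a unique root.** If
`det J(x) ≠ 0` for all `x ∈ 3B`, and for some `m ∈ (3/2)B` with `J(m)`
invertible the preconditioned system `g = J(m)⁻¹·f` is positive on each face
`(3B)_i^+` and negative on each face `(3B)_i^-` (i.e. the MK test succeeds on
`(3/2)B`), then `f` has exactly one zero in `3B`. -/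
theorem strict_jacobian_mk_unique (n : ℕ) (c : Fin n → ℝ) (w : ℝ) (hw : 0 < w)
    (f : (Fin n → ℝ) → (Fin n → ℝ)) (hf : ContDiff ℝ 2 f)
    (hjac : ∀ x ∈ box n c (3 * w), (Jmat n f x).det ≠ 0)
    (m : Fin n → ℝ) (hm : m ∈ box n c (3 / 2 * w)) (hJm : IsUnit (Jmat n f m))
    (g : (Fin n → ℝ) → (Fin n → ℝ)) (hg : ∀ x, g x = (Jmat n f m)⁻¹.mulVec (f x))
    (hplus : ∀ i : Fin n, ∀ x ∈ facePlus n c (3 * w) i, 0 < g x i)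
    (hminus : ∀ i : Fin n, ∀ x ∈ faceMinus n c (3 * w) i, g x i < 0) :
    ∃! x, x ∈ box n c (3 * w) ∧ f x = 0 := by
  have hfd : Differentiable ℝ f := hf.differentiable two_ne_zero
  have hgf : g = (Matrix.toLin' (Jmat n f m)⁻¹).toContinuousLinearMap ∘ f :=
    funext fun x => by simp [hg]
  have hg1 : ContDiff ℝ 1 g := by
    rw [hgf]
    exact (ContinuousLinearMap.contDiff _).comp (hf.of_le one_le_two)
  have hinv : IsUnit (Jmat n f m)⁻¹ := (Matrix.isUnit_nonsing_inv_iff).2 hJm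
  have hzero (x : Fin n → ℝ) : g x = 0 ↔ f x = 0 := by
    rw [hg]
    refine ⟨fun h => ?_, fun h => by rw [h, Matrix.mulVec_zero]⟩
    exact Matrix.mulVec_injective_of_isUnit hinv (h.trans (Matrix.mulVec_zero _).symm)
  have hJ (x : Fin n → ℝ) : (fderiv ℝ f x).det = (Jmat n f x).det := by
    rw [ContinuousLinearMap.det, ← LinearMap.det_toMatrix']
    congr 1
    ext i j
    rw [LinearMap.toMatrix'_apply, Jmat, pd,
      (hasFDerivAt_pi'.1 (hfd x).hasFDerivAt i).fderiv]
    rfl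
  have hdet (x : Fin n → ℝ) :
      (fderiv ℝ g x).det = (Jmat n f m)⁻¹.det * (Jmat n f x).det := by
    rw [hgf, ((ContinuousLinearMap.hasFDerivAt _).comp x (hfd x).hasFDerivAt).fderiv, ← hJ,
      ← LinearMap.det_toLin']
    exact LinearMap.det_comp _ _
  simp only [← hzero]
  refine existsUnique_zero_Icc_of_det_fderiv_ne_zero (fun i => by linarith) hg1
    (fun x hx => ?_) (fun x hx i hi => hminus i x ⟨hx, hi⟩) (fun x hx i hi => hplus i x ⟨hx, hi⟩)
  rw [hdet]
  exact mul_ne_zero ((Matrix.isUnit_iff_isUnit_det _).1 hinv).ne_zero (hjac x hx)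
end

section
/- Width bound for the interval determinant of the Jacobian: Let B ⊆ ℝⁿ be a box of width w > 0, let f : ℝⁿ → ℝⁿ be twice continuously differentiable, and let α ∈ B. Set U := max_{i,j} |∂f_i/∂x_j(α)| and V := max_{i,j} K(3B)_{ij}. For each i, j let R_{ij} := [min_{x∈3B} ∂f_i/∂x_j(x), max_{x∈3B} ∂f_i/∂x_j(x)]. Then for any two n×n real matrices M and M' with M_{ij}, M'_{ij} ∈ R_{ij} for all i, j, one has |det M − det M'| ≤ 3·n·n!·V·(U + 3Vw)^{n−1}·w. -/
/-- A product of `#s` factors bounded by `A` changes by at most `#s * D * A ^ (#s - 1)` when each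
factor changes by at most `D`. -/
theorem abs_prod_sub_prod_le {ι : Type*} (s : Finset ι) (a b : ι → ℝ) {A D : ℝ} (hA : 0 ≤ A)
    (ha : ∀ i ∈ s, |a i| ≤ A) (hb : ∀ i ∈ s, |b i| ≤ A) (hab : ∀ i ∈ s, |a i - b i| ≤ D) :
    |∏ i ∈ s, a i - ∏ i ∈ s, b i| ≤ s.card * D * A ^ (s.card - 1) := by
  classical
  induction s using Finset.induction_on with
  | empty => simp
  | insert i s hi ih =>
    simp only [Finset.forall_mem_insert] at ha hb hab
    have ih := ih ha.2 hb.2 hab.2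
    have hD : 0 ≤ D := (abs_nonneg _).trans hab.1
    have hprod : |∏ j ∈ s, a j| ≤ A ^ s.card := by
      rw [Finset.abs_prod]
      exact (Finset.prod_le_prod (fun _ _ => abs_nonneg _) ha.2).trans_eq (Finset.prod_const A)
    rw [Finset.prod_insert hi, Finset.prod_insert hi, Finset.card_insert_of_notMem hi]
    have hsplit : a i * ∏ j ∈ s, a j - b i * ∏ j ∈ s, b j =
        (a i - b i) * ∏ j ∈ s, a j + b i * (∏ j ∈ s, a j - ∏ j ∈ s, b j) := by ring
    calc |a i * ∏ j ∈ s, a j - b i * ∏ j ∈ s, b j|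
        ≤ |a i - b i| * |∏ j ∈ s, a j| + |b i| * |∏ j ∈ s, a j - ∏ j ∈ s, b j| := by
          rw [hsplit, ← abs_mul, ← abs_mul]
          exact abs_add_le _ _
      _ ≤ D * A ^ s.card + A * (s.card * D * A ^ (s.card - 1)) := by
          gcongr
          exacts [hab.1, hb.1]
      _ = ((s.card + 1 : ℕ) : ℝ) * D * A ^ (s.card + 1 - 1) := by
          rcases Nat.eq_zero_or_pos s.card with h | h
          · simp [h]
          · obtain ⟨k, hk⟩ := Nat.exists_eq_succ_of_ne_zero h.ne'
            rw [hk]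
            simp only [Nat.succ_eq_add_one, Nat.add_sub_cancel]
            push_cast
            ring

/-- Perturbation bound for the determinant in terms of entrywise bounds. -/
theorem abs_det_sub_det_le {n : ℕ} (M M' : Matrix (Fin n) (Fin n) ℝ) {A D : ℝ} (hA : 0 ≤ A)
    (hM : ∀ i j, |M i j| ≤ A) (hM' : ∀ i j, |M' i j| ≤ A)
    (hMM' : ∀ i j, |M i j - M' i j| ≤ D) :
    |M.det - M'.det| ≤ n.factorial * (n * D * A ^ (n - 1)) := by
  rw [Matrix.det_apply', Matrix.det_apply', ← Finset.sum_sub_distrib]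
  refine (Finset.abs_sum_le_sum_abs _ _).trans ?_
  have hterm : ∀ σ ∈ (Finset.univ : Finset (Equiv.Perm (Fin n))),
      |(Equiv.Perm.sign σ : ℝ) * ∏ i, M (σ i) i - (Equiv.Perm.sign σ : ℝ) * ∏ i, M' (σ i) i|
        ≤ n * D * A ^ (n - 1) := by
    intro σ _
    rw [← mul_sub, abs_mul]
    have hsign : |((Equiv.Perm.sign σ : ℤ) : ℝ)| = 1 := by
      rcases Int.units_eq_one_or (Equiv.Perm.sign σ) with h | h <;> simp [h]
    rw [hsign, one_mul]
    simpa using abs_prod_sub_prod_le Finset.univ (fun i => M (σ i) i) (fun i => M' (σ i) i) hA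
      (fun i _ => hM _ _) (fun i _ => hM' _ _) (fun i _ => hMM' _ _)
  refine (Finset.sum_le_card_nsmul _ _ _ hterm).trans ?_
  simp [Fintype.card_perm]

/-- The operator norm for the sup norm on `Fin n → ℝ` is at most the sum of the absolute values on
the standard basis. -/
theorem norm_clm_le_sum_single {n : ℕ} (L : (Fin n → ℝ) →L[ℝ] ℝ) :
    ‖L‖ ≤ ∑ k, |L (Pi.single k 1)| := by
  refine L.opNorm_le_bound (Finset.sum_nonneg fun _ _ => abs_nonneg _) fun v => ?_
  have hv : L v = ∑ k, v k * L (Pi.single k 1) := by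
    conv_lhs => rw [← Finset.univ_sum_single v, map_sum]
    refine Finset.sum_congr rfl fun k _ => ?_
    rw [← smul_eq_mul, ← map_smul, ← Pi.single_smul, smul_eq_mul, mul_one]
  rw [hv, Finset.sum_mul]
  refine (norm_sum_le _ _).trans (Finset.sum_le_sum fun k _ => ?_)
  rw [norm_mul, Real.norm_eq_abs (L _), mul_comm]
  exact mul_le_mul_of_nonneg_left (norm_le_pi_norm v k) (abs_nonneg _)

theorem norm_sub_le_of_mem_box {n : ℕ} {c x y : Fin n → ℝ} {w : ℝ} (hw : 0 ≤ w)
    (hx : x ∈ box n c w) (hy : y ∈ box n c w) : ‖x - y‖ ≤ w := by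
  refine (pi_norm_le_iff_of_nonneg hw).2 fun i => ?_
  have h1 := hx.1 i
  have h2 := hx.2 i
  have h3 := hy.1 i
  have h4 := hy.2 i
  simp only [Pi.sub_apply, Real.norm_eq_abs] at *
  rw [abs_le]
  constructor <;> linarith

theorem abs_pd_sub_pd_le {n : ℕ} {f : (Fin n → ℝ) → (Fin n → ℝ)} (hf : ContDiff ℝ 2 f)
    {c x y : Fin n → ℝ} {w : ℝ} (hw : 0 ≤ w) (i j : Fin n)
    (hx : x ∈ box n c w) (hy : y ∈ box n c w) :
    |pd n f i j x - pd n f i j y| ≤ Kmat n f (box n c w) i j * w := by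
  have hg := contDiff_pd hf i j
  have hbound : ∀ z ∈ box n c w, ‖fderiv ℝ (pd n f i j) z‖ ≤ Kmat n f (box n c w) i j := by
    intro z hz
    refine (norm_clm_le_sum_single _).trans (Finset.sum_le_sum fun k _ => ?_)
    have hcont : Continuous fun x => |fderiv ℝ (pd n f i j) x (Pi.single k 1)| :=
      ((hg.continuous_fderiv (by norm_num)).clm_apply continuous_const).abs
    exact le_csSup (isCompact_Icc.image hcont).bddAbove (Set.mem_image_of_mem _ hz)
  have hmvt := (convex_Icc _ _ : Convex ℝ (box n c w)).norm_image_sub_le_of_norm_fderiv_le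
    (fun z _ => (hg.differentiable (by norm_num)).differentiableAt) hbound hy hx
  exact hmvt.trans (mul_le_mul_of_nonneg_left (norm_sub_le_of_mem_box hw hx hy)
    ((norm_nonneg _).trans (hbound x hx)))

/-- Two points of the interval spanned by the values of a continuous function on a nonempty compact
set differ by at most the oscillation of the function. -/
theorem IsCompact.abs_sub_le_of_mem_Icc_sInf_sSup {X : Type*} [TopologicalSpace X] {s : Set X}
    (hs : IsCompact s) (hne : s.Nonempty) {g : X → ℝ} (hg : ContinuousOn g s) {D : ℝ}
    (hD : ∀ x ∈ s, ∀ y ∈ s, |g x - g y| ≤ D) {a b : ℝ}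
    (ha : a ∈ Set.Icc (sInf (g '' s)) (sSup (g '' s)))
    (hb : b ∈ Set.Icc (sInf (g '' s)) (sSup (g '' s))) : |a - b| ≤ D := by
  obtain ⟨x, hx, hxe⟩ := hs.exists_sInf_image_eq hne hg
  obtain ⟨y, hy, hye⟩ := hs.exists_sSup_image_eq hne hg
  have hxy := (le_abs_self _).trans (hD y hy x hx)
  rw [hxe, hye] at ha hb
  rw [abs_le]
  constructor <;> linarith [ha.1, ha.2, hb.1, hb.2]

theorem le_iSup_iSup_of_finite {ι κ : Type*} [Finite ι] [Finite κ] (g : ι → κ → ℝ) (i : ι)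
    (j : κ) : g i j ≤ ⨆ i, ⨆ j, g i j :=
  (le_ciSup (Set.finite_range (g i)).bddAbove j).trans
    (le_ciSup (f := fun i => ⨆ j, g i j) (Set.finite_range _).bddAbove i)

/-- **Width bound for the interval determinant of the Jacobian.** With
`U = max_{i,j} |∂f_i/∂x_j(α)|`, `V = max_{i,j} K(3B)_{ij}`, and
`R_{ij} = [min_{x∈3B} ∂f_i/∂x_j(x), max_{x∈3B} ∂f_i/∂x_j(x)]`, any two matrices
with entries in the `R_{ij}` have determinants differing by at most
`3·n·n!·V·(U + 3Vw)^{n−1}·w`. -/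
theorem interval_det_width_bound (n : ℕ) (c : Fin n → ℝ) (w : ℝ) (hw : 0 < w)
    (f : (Fin n → ℝ) → (Fin n → ℝ)) (hf : ContDiff ℝ 2 f)
    (α : Fin n → ℝ) (hα : α ∈ box n c w)
    (U V : ℝ)
    (hU : U = ⨆ i : Fin n, ⨆ j : Fin n, |pd n f i j α|)
    (hV : V = ⨆ i : Fin n, ⨆ j : Fin n, Kmat n f (box n c (3 * w)) i j)
    (M M' : Matrix (Fin n) (Fin n) ℝ)
    (hM : ∀ i j : Fin n, M i j ∈ Set.Icc
      (sInf ((fun x => pd n f i j x) '' box n c (3 * w)))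
      (sSup ((fun x => pd n f i j x) '' box n c (3 * w))))
    (hM' : ∀ i j : Fin n, M' i j ∈ Set.Icc
      (sInf ((fun x => pd n f i j x) '' box n c (3 * w)))
      (sSup ((fun x => pd n f i j x) '' box n c (3 * w)))) :
    |M.det - M'.det| ≤
      3 * n * (Nat.factorial n : ℝ) * V * (U + 3 * V * w) ^ (n - 1) * w := by
  rcases n.eq_zero_or_pos with rfl | hn
  · simp
  have hw3 : 0 ≤ 3 * w := by positivity
  have hα3 : α ∈ box n c (3 * w) :=
    ⟨fun i => by have := hα.1 i; dsimp only at *; linarith,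
      fun i => by have := hα.2 i; dsimp only at *; linarith⟩
  have hcompact : IsCompact (box n c (3 * w)) := isCompact_Icc
  have hcont : ∀ i j, Continuous (pd n f i j) := fun i j => (contDiff_pd hf i j).continuous
  have hosc : ∀ i j, ∀ x ∈ box n c (3 * w), ∀ y ∈ box n c (3 * w),
      |pd n f i j x - pd n f i j y| ≤ 3 * V * w := by
    intro i j x hx y hy
    have hKV : Kmat n f (box n c (3 * w)) i j ≤ V := hV ▸ le_iSup_iSup_of_finite _ i j
    calc |pd n f i j x - pd n f i j y| ≤ Kmat n f (box n c (3 * w)) i j * (3 * w) :=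
          abs_pd_sub_pd_le hf hw3 i j hx hy
      _ ≤ V * (3 * w) := mul_le_mul_of_nonneg_right hKV hw3
      _ = 3 * V * w := by ring
  have hdiff {i j : Fin n} {a b : ℝ} :=
    hcompact.abs_sub_le_of_mem_Icc_sInf_sSup ⟨α, hα3⟩ (hcont i j).continuousOn (hosc i j)
      (a := a) (b := b)
  have hentry {i j : Fin n} {a : ℝ} (ha : a ∈ Set.Icc (sInf (pd n f i j '' box n c (3 * w)))
      (sSup (pd n f i j '' box n c (3 * w)))) : |a| ≤ U + 3 * V * w := by
    have himage := hcompact.image (hcont i j)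
    have hmem := Set.mem_image_of_mem (pd n f i j) hα3
    have h1 := hdiff ha ⟨csInf_le himage.bddBelow hmem, le_csSup himage.bddAbove hmem⟩
    have h2 : |pd n f i j α| ≤ U := hU ▸ le_iSup_iSup_of_finite (fun i j => |pd n f i j α|) i j
    have h3 := abs_add_le (pd n f i j α) (a - pd n f i j α)
    rw [add_sub_cancel] at h3
    linarith
  have hA : 0 ≤ U + 3 * V * w := (abs_nonneg _).trans (hentry (hM ⟨0, hn⟩ ⟨0, hn⟩))
  refine (abs_det_sub_det_le M M' hA (fun i j => hentry (hM i j)) (fun i j => hentry (hM' i j))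
    (fun i j => hdiff (hM i j) (hM' i j))).trans_eq ?_
  ring
end
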